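/- arXiv:2408.08223 — 4 statements merged into one kernel-verified Lean document; each statement's English description precedes it below -/
import Mathlib

section
/- Let q ≥ 2 and k, ℓ ≥ 2 be integers with ℓ | k. Then (1/n)·log_q |{N_{k,ℓ}(x) : x ∈ Z_q^n}| tends to log_q λ_{k+ℓ−2,q} as n → ∞. -/
/-- The composition of a word over `Fin q`, as an element of `ℤ^q`:
it counts, for each letter `a`, the number of occurrences of `a`. -/
def comp {q : ℕ} (w : List (Fin q)) : Fin q → ℤ := fun a => (w.count a : ℤ)

/-- The `ℓ`-read vector of a word over `Fin q`: a word of length `n + ℓ - 1`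
over `ℤ^q` whose `p`-th entry is the composition of the window of the last `ℓ`
symbols ending at position `p` (symbols outside the word are omitted). -/
def readVec {q : ℕ} (ℓ : ℕ) (x : List (Fin q)) : List (Fin q → ℤ) :=
  (List.range (x.length + ℓ - 1)).map fun p => comp ((x.take (p + 1)).drop (p + 1 - ℓ))

/-- The `k`-step derivative of a word over an abelian group, with the
convention that entries at nonpositive positions are `0`. -/
def kderiv {G : Type*} [AddCommGroup G] (k : ℕ) (y : List G) : List G :=
  (List.range y.length).map fun i => y.getD i 0 - if k ≤ i then y.getD (i - k) 0 else 0

/-- The lengths `(m_0, m_1, ..., m_s)` of the maximal (possibly empty) runs of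
zeros in `y = 0^{m_0} y_1 0^{m_1} ⋯ y_s 0^{m_s}` with `y_1, ..., y_s ≠ 0`. -/
def zeroRuns {G : Type*} [Zero G] [DecidableEq G] (y : List G) : List ℕ :=
  (y.splitOnP fun a => decide (a ≠ 0)).map List.length

/-- `σ_k(y) = (⌊m_0/k⌋, ⌊m_1/k⌋, ..., ⌊m_s/k⌋)`. -/
def sigmak {G : Type*} [Zero G] [DecidableEq G] (k : ℕ) (y : List G) : List ℕ :=
  (zeroRuns y).map fun m => m / k

/-- Interleave zero runs of the given lengths with the given (nonzero) letters:
`assemble (m_0 :: ... :: m_s) (y_1 :: ... :: y_s) = 0^{m_0} y_1 0^{m_1} ⋯ y_s 0^{m_s}`. -/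
def assemble {G : Type*} [Zero G] : List ℕ → List G → List G
  | [], _ => []
  | m :: _, [] => List.replicate m (0 : G)
  | m :: ms, a :: as => List.replicate m (0 : G) ++ a :: assemble ms as

/-- `μ_k(y) = 0^{m_0 % k} y_1 0^{m_1 % k} ⋯ y_s 0^{m_s % k}`. -/
def muk {G : Type*} [Zero G] [DecidableEq G] (k : ℕ) (y : List G) : List G :=
  assemble ((zeroRuns y).map fun m => m % k) (y.filter fun a => decide (a ≠ 0))

/-- The nucleus `N_{k,ℓ}(x) = μ_k(Δ_k(R_ℓ(x)))` of a word over `Fin q`. -/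
def nucleus {q : ℕ} (k ℓ : ℕ) (x : List (Fin q)) : List (Fin q → ℤ) :=
  muk k (kderiv k (readVec ℓ x))

/-- A single tandem duplication of length `k`: `u v w ↦ u v v w` with `|v| = k`. -/
def TD {α : Type*} (k : ℕ) (y z : List α) : Prop :=
  ∃ u v w : List α, v.length = k ∧ y = u ++ (v ++ w) ∧ z = u ++ (v ++ (v ++ w))

/-- `TDt k t y z` holds iff `z` arises from `y` by a sequence of exactly `t`
tandem duplications of length `k`, i.e. `y ⟹_k^t z`. -/
def TDt {α : Type*} (k : ℕ) : ℕ → List α → List α → Prop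
  | 0 => fun y z => y = z
  | t + 1 => fun y z => ∃ w, TDt k t y w ∧ TD k w z

/-- The ball `B_{k,t}(y)`: all words obtained from `y` by at most `t` tandem
duplications of length `k`. -/
def Ball {α : Type*} (k t : ℕ) (y : List α) : Set (List α) :=
  {z | ∃ j ≤ t, TDt k j y z}

/-- `x` is `(k,ℓ)`-fine: it contains no `k`-periodic factor of length `2k+ℓ-1`. -/
def Fine {q : ℕ} (k ℓ : ℕ) (x : List (Fin q)) : Prop :=
  ∀ i : ℕ, 1 ≤ i → i + 2 * k + ℓ - 2 ≤ x.length →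
    (x.drop (i - 1)).take (k + ℓ - 1) ≠ (x.drop (i - 1 + k)).take (k + ℓ - 1)

/-- `y` contains the factor `0^k` (a run of `k` consecutive zeros). -/
def HasZeroBlock {G : Type*} [Zero G] (k : ℕ) (y : List G) : Prop :=
  ∃ j, j + k ≤ y.length ∧ (y.drop j).take k = List.replicate k (0 : G)

/-- `λ_{m,q}`: the largest real root of `x^{m+2} - q·x^{m+1} + q - 1`. -/
noncomputable def lambdaRoot (m q : ℕ) : ℝ :=
  sSup {x : ℝ | x ^ (m + 2) - (q : ℝ) * x ^ (m + 1) + (q : ℝ) - 1 = 0}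

/-- The dot product `a ⊙ b = Σ_{i=1}^{min(|a|,|b|)} a_i · b_i`. -/
def dot {G : Type*} [AddCommMonoid G] (a : List ℕ) (b : List G) : G :=
  (List.zipWith (fun m g => m • g) a b).sum

theorem comp_append {q : ℕ} (u v : List (Fin q)) : comp (u ++ v) = comp u + comp v := by
  funext a; simp [comp]

theorem comp_take_succ {q : ℕ} (x : List (Fin q)) (p : ℕ) (a : Fin q) :
    comp (x.take (p + 1)) a = comp (x.take p) a + if x[p]? = some a then 1 else 0 := by
  rw [List.take_add_one, comp_append, Pi.add_apply]
  congr 1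
  rcases h : x[p]? with _ | b
  · simp [comp]
  · simp [comp, List.count_singleton]

theorem comp_drop_take {q : ℕ} (x : List (Fin q)) {a b : ℕ} (h : b ≤ a) :
    comp ((x.take a).drop b) = comp (x.take a) - comp (x.take b) := by
  have h1 : x.take a = x.take b ++ (x.take a).drop b := by
    conv_lhs => rw [← List.take_append_drop b (x.take a)]
    rw [List.take_take, min_eq_left h]
  conv_rhs => rw [h1]
  rw [comp_append]; simp
  
/-- The composition of the last `k` symbols of the prefix of length `p`. -/
def blockComp {q : ℕ} (k : ℕ) (x : List (Fin q)) (p : ℕ) : Fin q → ℤ :=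
  comp (x.take p) - comp (x.take (p - k))

theorem length_kderiv_readVec {q : ℕ} (k ℓ : ℕ) (x : List (Fin q)) :
    (kderiv k (readVec ℓ x)).length = x.length + ℓ - 1 := by
  simp [kderiv, readVec]

theorem getElem_kderiv_readVec {q : ℕ} (k ℓ : ℕ) (x : List (Fin q)) (p : ℕ)
    (hp : p < (kderiv k (readVec ℓ x)).length) :
    (kderiv k (readVec ℓ x))[p] = blockComp k x (p + 1) - blockComp k x (p + 1 - ℓ) := by
  have hp' := hp
  rw [length_kderiv_readVec] at hp'
  have key : ∀ i, i < x.length + ℓ - 1 → (readVec ℓ x).getD i 0 =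
      comp (x.take (i + 1)) - comp (x.take (i + 1 - ℓ)) := by
    intro i hi
    rw [List.getD_eq_getElem _ _ (by simpa [readVec] using hi)]
    simp only [readVec, List.getElem_map, List.getElem_range]
    exact comp_drop_take x (Nat.sub_le _ _)
  simp only [kderiv, List.getElem_map, List.getElem_range, blockComp]
  rw [key p hp']
  split_ifs with h
  · rw [key _ (by omega)]
    rw [show p - k + 1 = p + 1 - k by omega, show p + 1 - k - ℓ = p + 1 - ℓ - k by omega]
    abel
  · rw [show p + 1 - k = 0 by omega, show p + 1 - ℓ - k = 0 by omega]
    abel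

theorem kderiv_readVec_injective {q : ℕ} {k ℓ : ℕ} (hk : 1 ≤ k) (hl : 1 ≤ ℓ)
    {x x' : List (Fin q)} (hlen : x.length = x'.length)
    (h : kderiv k (readVec ℓ x) = kderiv k (readVec ℓ x')) : x = x' := by
  have key : ∀ p, p ≤ x.length → comp (x.take p) = comp (x'.take p) := by
    intro p
    induction p using Nat.strong_induction_on with
    | _ p ih =>
      intro hp
      rcases p with _ | p
      · simp
      · have h1 : p < (kderiv k (readVec ℓ x)).length := by
          rw [length_kderiv_readVec]; omega
        have h2 := getElem_kderiv_readVec k ℓ x p h1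
        have h3 := getElem_kderiv_readVec k ℓ x' p (h ▸ h1)
        simp only [h] at h2
        rw [h3] at h2
        simp only [blockComp] at h2
        rw [ih (p + 1 - k) (by omega) (by omega), ih (p + 1 - ℓ) (by omega) (by omega),
          ih (p + 1 - ℓ - k) (by omega) (by omega)] at h2
        simpa using h2.symm
  apply List.ext_getElem hlen
  intro i hi hi'
  have h1 := comp_take_succ x i x[i]
  have h2 := comp_take_succ x' i x[i]
  rw [key (i + 1) (by omega), key i (by omega), h2] at h1
  simpa [hi, hi', eq_comm] using h1

/-- `x` contains a `k`-periodic factor of length `r + k`. -/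
def HasPeriodicFactor {α : Type*} (k r : ℕ) (x : List α) : Prop :=
  ∃ j, j + r + k ≤ x.length ∧ ∀ i < r, x[j + i]? = x[j + i + k]?

theorem HasPeriodicFactor.reverse {α : Type*} {k r : ℕ} {x : List α}
    (h : HasPeriodicFactor k r x) : HasPeriodicFactor k r x.reverse := by
  obtain ⟨j, hj, h⟩ := h
  refine ⟨x.length - (j + r + k), by simp; omega, fun i hi => ?_⟩
  rw [List.getElem?_reverse (by omega), List.getElem?_reverse (by omega)]
  have := h (r - 1 - i) (by omega)
  rw [show x.length - 1 - (x.length - (j + r + k) + i) = j + (r - 1 - i) + k by omega,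
    show x.length - 1 - (x.length - (j + r + k) + i + k) = j + (r - 1 - i) by omega, this]

theorem blockComp_succ {q : ℕ} {k : ℕ} (x : List (Fin q)) (p : ℕ) (a : Fin q) :
    blockComp k x (p + 1) a = blockComp k x p a + (if x[p]? = some a then 1 else 0)
      - if k ≤ p ∧ x[p - k]? = some a then 1 else 0 := by
  simp only [blockComp, Pi.sub_apply, comp_take_succ x p a]
  by_cases h : k ≤ p
  · rw [show p + 1 - k = p - k + 1 by omega, comp_take_succ x (p - k) a]
    simp [h]; ring
  · rw [show p + 1 - k = 0 by omega, show p - k = 0 by omega]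
    simp [h]; ring

theorem exists_ne_zero_of_not_hasPeriodicFactor {q k ℓ : ℕ} (hl : 2 ≤ ℓ) (hk : 2 ≤ k)
    (hdvd : ℓ ∣ k) {x : List (Fin q)} (hx : ¬ HasPeriodicFactor k (k + ℓ - 1) x) {s : ℕ}
    (hs : s + k ≤ (kderiv k (readVec ℓ x)).length) :
    ∃ p, ∃ hp : p < (kderiv k (readVec ℓ x)).length, s ≤ p ∧ p < s + k ∧
      (kderiv k (readVec ℓ x))[p] ≠ 0 := by
  by_contra! hcon
  have hlk : ℓ ≤ k := Nat.le_of_dvd (by omega) hdvd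
  have hs' := hs
  rw [length_kderiv_readVec] at hs'
  have hD : ∀ t, s + 1 ≤ t + ℓ → t + ℓ ≤ s + k → blockComp k x (t + ℓ) = blockComp k x t := by
    intro t h1 h2
    have := hcon (t + ℓ - 1) (by omega) (by omega) (by omega)
    rw [getElem_kderiv_readVec, show t + ℓ - 1 + 1 = t + ℓ by omega,
      show t + ℓ - ℓ = t by omega, sub_eq_zero] at this
    exact this
  have hDk : ∀ t, s + 1 ≤ t + ℓ → t ≤ s → blockComp k x (t + k) = blockComp k x t := by
    intro t h1 h2
    obtain ⟨d, rfl⟩ := hdvd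
    have : ∀ e ≤ d, blockComp (ℓ * d) x (t + ℓ * e) = blockComp (ℓ * d) x t := by
      intro e
      induction e with
      | zero => simp
      | succ e ih =>
        intro he
        have h3 : ℓ * (e + 1) ≤ ℓ * d := Nat.mul_le_mul_left _ he
        rw [mul_add, mul_one] at h3 ⊢
        rw [← add_assoc, hD (t + ℓ * e) (by omega) (by omega), ih (by omega)]
    exact this d le_rfl
  have hn : 0 < x.length := by omega
  have hper : ∀ t, s + 1 ≤ t + ℓ → t + 1 ≤ s → k ≤ t ∧ blockComp k x (t + 1) = blockComp k x t := by
    intro t h1 h2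
    have ht : t < x.length := by omega
    have e1 := hDk t h1 (by omega)
    have e2 := hDk (t + 1) (by omega) h2
    have f1 := blockComp_succ (k := k) x t x[t]
    have f2 := blockComp_succ (k := k) x (t + k) x[t]
    rw [show t + k + 1 = t + 1 + k by omega, e1, e2, f1] at f2
    simp only [Nat.add_sub_cancel, Nat.le_add_left, true_and] at f2
    rw [if_pos (List.getElem?_eq_getElem ht)] at f2 f1
    have hA : k ≤ t ∧ x[t - k]? = some x[t] := by
      by_contra hA
      rw [if_neg hA] at f2
      split_ifs at f2 <;> omega
    refine ⟨hA.1, ?_⟩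
    funext a
    rw [blockComp_succ, List.getElem?_eq_getElem ht, hA.2]
    simp [hA.1]
  have hs0 : 1 ≤ s := by
    by_contra h0
    obtain rfl : s = 0 := by omega
    have := hcon 0 (by omega) (by omega) (by omega)
    rw [getElem_kderiv_readVec, show 0 + 1 - ℓ = 0 by omega, sub_eq_zero] at this
    have f1 := blockComp_succ (k := k) x 0 x[0]
    rw [this, if_pos (List.getElem?_eq_getElem hn), if_neg (by omega)] at f1
    omega
  have hbig := (hper (s + 1 - ℓ) (by omega) (by omega)).1
  have hconst : ∀ i, i < k + ℓ → blockComp k x (s + 1 - ℓ + i) = blockComp k x (s + 1 - ℓ) := by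
    intro i
    induction i using Nat.strong_induction_on with
    | _ i ih =>
      intro hi
      by_cases hi1 : i < ℓ
      · rcases i with _ | i
        · rfl
        · rw [← ih i (by omega) (by omega)]
          exact (hper (s + 1 - ℓ + i) (by omega) (by omega)).2
      · have := hD (s + 1 - ℓ + (i - ℓ)) (by omega) (by omega)
        rw [show s + 1 - ℓ + (i - ℓ) + ℓ = s + 1 - ℓ + i by omega] at this
        rw [this, ih (i - ℓ) (by omega) (by omega)]
  have hin : ∀ i < k + ℓ - 1, s + 1 - ℓ + i < x.length →
      x[s + 1 - ℓ - k + i]? = x[s + 1 - ℓ + i]? := by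
    intro i hi hlt
    have f := blockComp_succ (k := k) x (s + 1 - ℓ + i) x[s + 1 - ℓ + i]
    rw [add_assoc, hconst (i + 1) (by omega), hconst i (by omega),
      if_pos (List.getElem?_eq_getElem hlt)] at f
    have hA : k ≤ s + 1 - ℓ + i ∧ x[s + 1 - ℓ + i - k]? = some x[s + 1 - ℓ + i] := by
      by_contra hA
      rw [if_neg hA] at f
      omega
    rw [List.getElem?_eq_getElem hlt, ← hA.2]
    congr 1
    omega
  have hlen : s + k ≤ x.length := by
    by_contra hlen
    have hlt : s + 1 - ℓ ≤ x.length - k ∧ k ≤ x.length := by omega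
    have f := blockComp_succ (k := k) x x.length (x[x.length - k]'(by omega))
    have c1 := hconst (x.length + 1 - (s + 1 - ℓ)) (by omega)
    have c2 := hconst (x.length - (s + 1 - ℓ)) (by omega)
    rw [show s + 1 - ℓ + (x.length + 1 - (s + 1 - ℓ)) = x.length + 1 by omega] at c1
    rw [show s + 1 - ℓ + (x.length - (s + 1 - ℓ)) = x.length by omega] at c2
    rw [c1, c2, if_neg (by simp), if_pos ⟨hlt.2, List.getElem?_eq_getElem _⟩] at f
    omega
  apply hx
  refine ⟨s + 1 - ℓ - k, by omega, fun i hi => ?_⟩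
  rw [hin i hi (by omega)]
  congr 1
  omega

theorem exists_eq_replicate_or_append_cons {G : Type*} [Zero G] (y : List G) :
    (∃ m, y = List.replicate m 0) ∨
      ∃ m a y', a ≠ 0 ∧ y = List.replicate m 0 ++ a :: y' := by
  induction y with
  | nil => exact Or.inl ⟨0, rfl⟩
  | cons b y ih =>
    by_cases hb : b = 0
    · subst hb
      rcases ih with ⟨m, rfl⟩ | ⟨m, a, y', ha, rfl⟩
      · exact Or.inl ⟨m + 1, rfl⟩
      · exact Or.inr ⟨m + 1, a, y', ha, rfl⟩
    · exact Or.inr ⟨0, b, y, hb, rfl⟩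

section RunReduction

variable {G : Type*} [Zero G] [DecidableEq G]

theorem muk_replicate (k m : ℕ) :
    muk k (List.replicate m (0 : G)) = List.replicate (m % k) 0 := by
  have h : ∀ x ∈ List.replicate m (0 : G), (fun a : G => decide (a ≠ 0)) x = false := by
    intro x hx; simp [List.eq_of_mem_replicate hx]
  have h2 : (List.replicate m (0 : G)).filter (fun a => decide (a ≠ 0)) = [] := by
    rw [List.filter_eq_nil_iff]; intro x hx; simp [List.eq_of_mem_replicate hx]
  rw [muk, zeroRuns, List.splitOnP_eq_singleton h, h2]
  simp [assemble]

theorem muk_replicate_append_cons (k m : ℕ) {a : G} (ha : a ≠ 0) (y : List G) :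
    muk k (List.replicate m 0 ++ a :: y) = List.replicate (m % k) 0 ++ a :: muk k y := by
  have h : ∀ x ∈ List.replicate m (0 : G), (fun a : G => decide (a ≠ 0)) x = false := by
    intro x hx; simp [List.eq_of_mem_replicate hx]
  have h2 : (List.replicate m (0 : G)).filter (fun a => decide (a ≠ 0)) = [] := by
    rw [List.filter_eq_nil_iff]; intro x hx; simp [List.eq_of_mem_replicate hx]
  rw [muk, zeroRuns, List.splitOnP_append_cons_of_forall_mem h a (by simpa using ha),
    List.filter_append, h2]
  simp [assemble, ha, muk, zeroRuns]

theorem muk_append_replicate_append (k : ℕ) (u v : List G) :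
    muk k (u ++ (List.replicate k 0 ++ v)) = muk k (u ++ v) := by
  induction h : u.length using Nat.strong_induction_on generalizing u with
  | _ n ih =>
    rcases exists_eq_replicate_or_append_cons u with ⟨m, rfl⟩ | ⟨m, a, u', ha, rfl⟩
    · rw [← List.append_assoc, List.replicate_append_replicate]
      rcases exists_eq_replicate_or_append_cons v with ⟨m', rfl⟩ | ⟨m', b, v', hb, rfl⟩
      · rw [List.replicate_append_replicate, List.replicate_append_replicate, muk_replicate,
          muk_replicate, add_right_comm, Nat.add_mod_right]
      · rw [← List.append_assoc, ← List.append_assoc, List.replicate_append_replicate,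
          List.replicate_append_replicate, muk_replicate_append_cons _ _ hb,
          muk_replicate_append_cons _ _ hb, add_right_comm, Nat.add_mod_right]
    · simp only [List.append_assoc, List.cons_append]
      rw [muk_replicate_append_cons _ _ ha, muk_replicate_append_cons _ _ ha,
        ih u'.length (by simp at h; omega) u' rfl]

theorem muk_eq_self {k : ℕ} (y : List G)
    (h : ∀ s, s + k ≤ y.length → ∃ p, ∃ hp : p < y.length, s ≤ p ∧ p < s + k ∧ y[p] ≠ 0) :
    muk k y = y := by
  induction hn : y.length using Nat.strong_induction_on generalizing y with
  | _ n ih =>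
    rcases exists_eq_replicate_or_append_cons y with ⟨m, rfl⟩ | ⟨m, a, u, ha, rfl⟩
    · rw [muk_replicate]
      congr 1
      apply Nat.mod_eq_of_lt
      by_contra! hmk
      obtain ⟨p, hp, -, -, hne⟩ := h 0 (by simpa using hmk)
      simp at hne
    · have hm : m < k := by
        by_contra! hmk
        obtain ⟨p, hp, -, h2, hne⟩ := h 0 (by simp; omega)
        rw [List.getElem_append_left (by simp; omega)] at hne
        simp at hne
      rw [muk_replicate_append_cons _ _ ha, Nat.mod_eq_of_lt hm,
        ih u.length (by simp at hn; omega) u ?_ rfl]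
      intro s hs
      obtain ⟨p, hp, h1, h2, hne⟩ := h (m + 1 + s) (by simp; omega)
      simp only [List.length_append, List.length_replicate, List.length_cons] at hp
      refine ⟨p - (m + 1), by omega, by omega, by omega, ?_⟩
      rw [List.getElem_append_right (by simp; omega)] at hne
      simp only [List.length_replicate] at hne
      rw [List.getElem_cons, dif_neg (by omega)] at hne
      simpa [Nat.sub_sub] using hne

theorem muk_take_append_drop {k s : ℕ} (y : List G) (hs : s + k ≤ y.length)
    (h : ∀ p (hp : p < y.length), s ≤ p → p < s + k → y[p] = 0) :
    muk k (y.take s ++ y.drop (s + k)) = muk k y := by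
  rw [← muk_append_replicate_append]
  congr 1
  have : (y.drop s).take k = List.replicate k 0 := by
    apply List.ext_getElem
    · simp; omega
    · intro i h1 h2
      simp only [List.length_replicate] at h2
      simp [h (s + i) (by omega) (by omega) (by omega)]
  rw [← this, ← List.drop_drop, List.take_append_drop, List.take_append_drop]

end RunReduction

theorem comp_take_delete_of_le {q : ℕ} (x : List (Fin q)) {j p : ℕ} (k : ℕ) (hp : p ≤ j)
    (hj : j ≤ x.length) :
    comp ((x.take j ++ x.drop (j + k)).take p) = comp (x.take p) := by
  rw [List.take_append_of_le_length (by simp; omega), List.take_take, min_eq_left hp]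

theorem comp_take_delete_of_ge {q : ℕ} (x : List (Fin q)) {j p : ℕ} (k : ℕ) (hp : j ≤ p)
    (hj : j ≤ x.length) :
    comp ((x.take j ++ x.drop (j + k)).take p) =
      comp (x.take (p + k)) - comp (x.take (j + k)) + comp (x.take j) := by
  rw [← comp_drop_take x (by omega : j + k ≤ p + k), List.take_append,
    List.take_of_length_le (by simp; omega), comp_append, List.drop_take, add_comm]
  congr 3
  simp
  omega

theorem exists_nucleus_eq_of_hasPeriodicFactor {q k ℓ : ℕ} (hl : 1 ≤ ℓ)
    {x : List (Fin q)} (hx : HasPeriodicFactor k (k + ℓ - 1) x) :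
    ∃ x' : List (Fin q), x'.length + k = x.length ∧ nucleus k ℓ x' = nucleus k ℓ x := by
  obtain ⟨j₀, hj₀, hper⟩ := hx
  set j := j₀ + k with hjdef
  have hconst : ∀ i, i ≤ k + ℓ - 1 → blockComp k x (j + i) = blockComp k x j := by
    intro i
    induction i with
    | zero => simp
    | succ i ih =>
      intro hi
      rw [← ih (by omega)]
      funext a
      rw [← add_assoc, blockComp_succ]
      have := hper i (by omega)
      rw [show j₀ + i + k = j + i by omega] at this
      rw [show j + i - k = j₀ + i by omega, this]
      simp [show k ≤ j + i by omega]
  have hconst' : ∀ p, j ≤ p → p ≤ j + (k + ℓ - 1) → blockComp k x p = blockComp k x j := by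
    intro p h1 h2
    have := hconst (p - j) (by omega)
    rwa [show j + (p - j) = p by omega] at this
  set x' := x.take j ++ x.drop (j + k) with hx'
  have hlen : x'.length + k = x.length := by simp [hx']; omega
  have hge : ∀ p, j ≤ p → blockComp k x' p = blockComp k x (p + k) := by
    intro p hp
    by_cases h : j + k ≤ p
    · simp only [blockComp, hx']
      rw [comp_take_delete_of_ge x k hp (by omega), comp_take_delete_of_ge x k (by omega) (by omega),
        show p - k + k = p by omega, show p + k - k = p by omega]
      abel
    · have e1 := hconst' p hp (by omega)
      have e2 := hconst' (j + k) (by omega) (by omega)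
      rw [← e2] at e1
      simp only [blockComp, hx'] at e1 ⊢
      rw [comp_take_delete_of_ge x k hp (by omega), comp_take_delete_of_le x k (by omega) (by omega),
        show p + k - k = p by omega]
      rw [Nat.add_sub_cancel] at e1
      rw [sub_eq_iff_eq_add] at e1
      rw [e1]
      abel
  have hle : ∀ p, p ≤ j + ℓ - 1 → blockComp k x' p = blockComp k x p := by
    intro p hp
    by_cases h : p ≤ j
    · simp only [blockComp, hx']
      rw [comp_take_delete_of_le x k h (by omega), comp_take_delete_of_le x k (by omega) (by omega)]
    · rw [hge p (by omega), hconst' p (by omega) (by omega), hconst' (p + k) (by omega) (by omega)]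
  refine ⟨x', hlen, ?_⟩
  rw [nucleus, nucleus, ← muk_take_append_drop (k := k) (s := j + ℓ - 1) (kderiv k (readVec ℓ x))]
  · congr 1
    apply List.ext_getElem
    · simp only [List.length_append, List.length_take, List.length_drop, length_kderiv_readVec]
      omega
    · intro p h1 h2
      have h1' := h1
      rw [length_kderiv_readVec] at h1'
      by_cases hp : p < j + ℓ - 1
      · rw [List.getElem_append_left (by simp [length_kderiv_readVec]; omega), List.getElem_take,
          getElem_kderiv_readVec, getElem_kderiv_readVec, hle _ (by omega), hle _ (by omega)]
      · have hl1 : ((kderiv k (readVec ℓ x)).take (j + ℓ - 1)).length = j + ℓ - 1 := by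
          simp [length_kderiv_readVec]; omega
        rw [List.getElem_append_right (by omega), List.getElem_drop,
          getElem_kderiv_readVec, getElem_kderiv_readVec, hge _ (by omega), hge _ (by omega), hl1,
          show j + ℓ - 1 + k + (p - (j + ℓ - 1)) + 1 = p + 1 + k by omega,
          show p + 1 + k - ℓ = p + 1 - ℓ + k by omega]
  · rw [length_kderiv_readVec]; omega
  · intro p hp h1 h2
    rw [getElem_kderiv_readVec, hconst' (p + 1) (by omega) (by omega),
      hconst' (p + 1 - ℓ) (by omega) (by omega), sub_self]

theorem HasPeriodicFactor.cons {α : Type*} {k r : ℕ} {w : List α} (h : HasPeriodicFactor k r w) (a : α) :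
    HasPeriodicFactor k r (a :: w) := by
  obtain ⟨j, hj, h⟩ := h
  refine ⟨j + 1, by simp; omega, fun i hi => ?_⟩
  rw [show j + 1 + i + k = j + i + k + 1 by omega, show j + 1 + i = j + i + 1 by omega,
    List.getElem?_cons_succ, List.getElem?_cons_succ]
  exact h i hi

/-- The length of the current run of agreements of letters with their `k`-th successors at the
head of a word, frozen at `r` once this value has been reached. -/
def periodRun {α : Type*} [DecidableEq α] (k r : ℕ) : List α → ℕ
  | [] => 0
  | a :: w =>
    if periodRun k r w = r then r
    else if w[k - 1]? = some a then periodRun k r w + 1 else 0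

section PeriodRun

variable {α : Type*} [DecidableEq α]

theorem periodRun_le (k r : ℕ) (w : List α) : periodRun k r w ≤ r := by
  induction w with
  | nil => simp [periodRun]
  | cons a w ih => rw [periodRun]; split_ifs <;> omega

theorem le_periodRun {k r t : ℕ} (hk : 1 ≤ k) (htr : t ≤ r) {w : List α}
    (hw : t + k ≤ w.length) (h : ∀ i < t, w[i]? = w[i + k]?) : t ≤ periodRun k r w := by
  induction w generalizing t with
  | nil => simp at hw; omega
  | cons a w ih =>
    rcases t with _ | t
    · omega
    · have h1 : t ≤ periodRun k r w := by
        apply ih (by omega) (by simp at hw; omega)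
        intro i hi
        have := h (i + 1) (by omega)
        rwa [show i + 1 + k = i + k + 1 by omega, List.getElem?_cons_succ,
          List.getElem?_cons_succ] at this
      have h2 := h 0 (by omega)
      rw [show 0 + k = k - 1 + 1 by omega, List.getElem?_cons_succ, List.getElem?_cons_zero] at h2
      rw [periodRun]
      split_ifs with h3 h4
      · omega
      · omega
      · exact absurd h2.symm h4

theorem periodic_of_periodRun {k r : ℕ} (hk : 1 ≤ k) {w : List α} (h : periodRun k r w < r) :
    ∀ i < periodRun k r w, i + k < w.length ∧ w[i]? = w[i + k]? := by
  induction w with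
  | nil => simp [periodRun]
  | cons a w ih =>
    rw [periodRun] at h ⊢
    split_ifs at h ⊢ with h1 h2
    · omega
    · intro i hi
      rcases i with _ | i
      · rw [show 0 + k = k - 1 + 1 by omega, List.getElem?_cons_succ, h2]
        obtain ⟨h3, -⟩ := List.getElem?_eq_some_iff.1 h2
        refine ⟨by simp; omega, by simp⟩
      · obtain ⟨h3, h4⟩ := ih (by omega) i (by omega)
        rw [show i + 1 + k = i + k + 1 by omega, List.getElem?_cons_succ,
          List.getElem?_cons_succ]
        exact ⟨by simpa using h3, h4⟩
    · simp

theorem periodRun_eq_iff {k r : ℕ} (hk : 1 ≤ k) (hr : 1 ≤ r) (w : List α) :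
    periodRun k r w = r ↔ HasPeriodicFactor k r w := by
  induction w with
  | nil =>
    simp only [periodRun, HasPeriodicFactor, List.length_nil]
    exact ⟨fun h => by omega, fun ⟨j, h, _⟩ => by omega⟩
  | cons a w ih =>
    by_cases h : periodRun k r w = r
    · exact ⟨fun _ => (ih.1 h).cons a, fun _ => by simp [periodRun, h]⟩
    constructor
    · intro h1
      rw [periodRun, if_neg h] at h1
      split_ifs at h1 with h2
      · have hlt : periodRun k r w < r := lt_of_le_of_ne (periodRun_le k r w) h
        have h3 := periodic_of_periodRun hk hlt
        obtain ⟨h4, -⟩ := List.getElem?_eq_some_iff.1 h2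
        refine ⟨0, ?_, fun i hi => ?_⟩
        · rcases Nat.lt_or_ge 1 r with hr' | hr'
          · have := (h3 (r - 2) (by omega)).1
            simp; omega
          · simp; omega
        · rw [zero_add]
          rcases i with _ | i
          · rw [show 0 + k = k - 1 + 1 by omega, List.getElem?_cons_succ, h2]
            simp
          · rw [show i + 1 + k = i + k + 1 by omega, List.getElem?_cons_succ,
              List.getElem?_cons_succ]
            exact (h3 i (by omega)).2
      · omega
    · rintro ⟨j, hj, hper⟩
      rcases j with _ | j
      · exact le_antisymm (periodRun_le _ _ _)
          (le_periodRun hk le_rfl (by omega) fun i hi => by simpa using hper i hi)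
      · refine absurd (ih.2 ⟨j, by simp at hj; omega, fun i hi => ?_⟩) h
        have := hper i hi
        rwa [show j + 1 + i + k = j + i + k + 1 by omega, show j + 1 + i = j + i + 1 by omega,
          List.getElem?_cons_succ, List.getElem?_cons_succ] at this

end PeriodRun

theorem lambdaRoot_spec {m q : ℕ} (hm : 1 ≤ m) (hq : 2 ≤ q) :
    1 < lambdaRoot m q ∧
      lambdaRoot m q ^ (m + 2) - (q : ℝ) * lambdaRoot m q ^ (m + 1) + (q : ℝ) - 1 = 0 := by
  have hq' : (2 : ℝ) ≤ q := by exact_mod_cast hq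
  have hm' : (1 : ℝ) ≤ m := by exact_mod_cast hm
  set h : ℝ → ℝ := fun x => x ^ (m + 1) - (q - 1) * ∑ i ∈ Finset.range (m + 1), x ^ i with hh
  have hfac : ∀ x : ℝ, x ^ (m + 2) - (q : ℝ) * x ^ (m + 1) + (q : ℝ) - 1 = (x - 1) * h x := by
    intro x
    have := geom_sum_mul x (m + 1)
    rw [hh]
    linear_combination ((q : ℝ) - 1) * this
  have hcont : Continuous h := by fun_prop
  have h1 : h 1 < 0 := by simp [hh]; nlinarith
  have h2 : 0 < h q := by
    have := geom_sum_mul (q : ℝ) (m + 1)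
    simp only [hh]
    rw [mul_comm, this]
    linarith
  obtain ⟨x, hx, hx0⟩ := intermediate_value_Ioo (by linarith) hcont.continuousOn
    (Set.mem_Ioo.2 ⟨h1, h2⟩)
  set S : Set ℝ := {x : ℝ | x ^ (m + 2) - (q : ℝ) * x ^ (m + 1) + (q : ℝ) - 1 = 0} with hS
  have hxS : x ∈ S := by rw [hS, Set.mem_ofPred_eq, hfac, hx0, mul_zero]
  have hbdd : BddAbove S := by
    refine ⟨q, fun y hy => ?_⟩
    by_contra! hlt
    have h3 : y ^ (m + 2) - (q : ℝ) * y ^ (m + 1) + (q : ℝ) - 1 = 0 := hy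
    have h4 : 0 < y ^ (m + 1) * (y - q) := by
      apply mul_pos (pow_pos (by linarith) _) (by linarith)
    rw [pow_succ] at h3
    nlinarith
  have hclosed : IsClosed S := isClosed_eq (by fun_prop) continuous_const
  exact ⟨lt_of_lt_of_le hx.1 (le_csSup hbdd hxS), hclosed.csSup_mem ⟨x, hxS⟩ hbdd⟩

/-- The finite set of words of a given length over `Fin q`. -/
def words (q : ℕ) : ℕ → Finset (List (Fin q))
  | 0 => {[]}
  | m + 1 => (Finset.univ ×ˢ words q m).image fun p => p.1 :: p.2

theorem mem_words {q m : ℕ} {w : List (Fin q)} : w ∈ words q m ↔ w.length = m := by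
  induction m generalizing w with
  | zero => simp [words]
  | succ m ih =>
    cases w with
    | nil => simp [words]
    | cons a w => simp [words, ih]

theorem sum_words_succ {q : ℕ} (m : ℕ) (f : List (Fin q) → ℝ) :
    ∑ w ∈ words q (m + 1), f w = ∑ w ∈ words q m, ∑ a, f (a :: w) := by
  rw [words, Finset.sum_image, Finset.sum_product_right]
  rintro ⟨a, w⟩ - ⟨b, w'⟩ - h
  simpa using h

theorem card_words (q m : ℕ) : ((words q m).card : ℝ) = (q : ℝ) ^ m := by
  induction m with
  | zero => simp [words]
  | succ m ih =>
    have := sum_words_succ (q := q) m (fun _ => 1)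
    simp only [Finset.sum_const, nsmul_eq_mul, mul_one, Finset.card_univ, Fintype.card_fin] at this
    rw [this, ih, pow_succ]

section Potential

variable {q k r : ℕ} {lam : ℝ}

theorem sum_potential_cons (hroot : lam ^ (r + 1) - q * lam ^ r + q - 1 = 0)
    {w : List (Fin q)} {b : Fin q} (hb : w[k - 1]? = some b) :
    ∑ a, (lam ^ r - lam ^ periodRun k r (a :: w)) = lam * (lam ^ r - lam ^ periodRun k r w) := by
  by_cases h : periodRun k r w = r
  · simp [periodRun, h]
  · have : ∀ a, lam ^ r - lam ^ periodRun k r (a :: w) =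
        (lam ^ r - 1) + if b = a then 1 - lam ^ (periodRun k r w + 1) else 0 := by
      intro a
      rw [periodRun, if_neg h, hb]
      by_cases hab : b = a
      · simp [hab]
      · simp [hab]
    simp only [this, Finset.sum_add_distrib, Finset.sum_const, Finset.card_univ,
      Fintype.card_fin, nsmul_eq_mul, Finset.sum_ite_eq, Finset.mem_univ, if_true]
    linear_combination -hroot

theorem le_sum_potential_cons (hlam : 1 < lam) (hroot : lam ^ (r + 1) - q * lam ^ r + q - 1 = 0)
    (w : List (Fin q)) :
    lam * (lam ^ r - lam ^ periodRun k r w) ≤ ∑ a, (lam ^ r - lam ^ periodRun k r (a :: w)) := by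
  rcases hb : w[k - 1]? with _ | b
  · by_cases h : periodRun k r w = r
    · simp [periodRun, h]
    · simp only [periodRun, if_neg h, hb]
      have : 1 ≤ lam ^ (periodRun k r w + 1) := one_le_pow₀ hlam.le
      simp
      rw [pow_succ] at this hroot
      nlinarith
  · exact (sum_potential_cons hroot hb).ge

theorem le_sum_potential (hlam : 1 < lam) (hroot : lam ^ (r + 1) - q * lam ^ r + q - 1 = 0)
    (m : ℕ) :
    lam ^ m * (lam ^ r - 1) ≤ ∑ w ∈ words q m, (lam ^ r - lam ^ periodRun k r w) := by
  induction m with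
  | zero => simp [words, periodRun]
  | succ m ih =>
    rw [sum_words_succ]
    calc lam ^ (m + 1) * (lam ^ r - 1) = lam * (lam ^ m * (lam ^ r - 1)) := by ring
      _ ≤ lam * ∑ w ∈ words q m, (lam ^ r - lam ^ periodRun k r w) := by gcongr
      _ ≤ _ := by
        rw [Finset.mul_sum]
        exact Finset.sum_le_sum fun w _ => le_sum_potential_cons hlam hroot w

theorem sum_potential_le (hq : 1 ≤ q) (hk : 1 ≤ k) (hlam : 1 < lam)
    (hroot : lam ^ (r + 1) - q * lam ^ r + q - 1 = 0) (m : ℕ) :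
    ∑ w ∈ words q m, (lam ^ r - lam ^ periodRun k r w) ≤ q ^ k * (lam ^ r - 1) * lam ^ m := by
  have hr : 0 ≤ lam ^ r - 1 := sub_nonneg.2 (one_le_pow₀ hlam.le)
  have hq' : (1 : ℝ) ≤ q := by exact_mod_cast hq
  induction m with
  | zero =>
    simp only [words, periodRun, Finset.sum_singleton, pow_zero, mul_one]
    exact le_mul_of_one_le_left hr (one_le_pow₀ hq')
  | succ m ih =>
    by_cases hkm : k ≤ m
    · rw [sum_words_succ]
      calc _ = lam * ∑ w ∈ words q m, (lam ^ r - lam ^ periodRun k r w) := by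
            rw [Finset.mul_sum]
            refine Finset.sum_congr rfl fun w hw => ?_
            have hlt : k - 1 < w.length := by rw [mem_words.1 hw]; omega
            exact sum_potential_cons hroot (List.getElem?_eq_getElem hlt)
        _ ≤ lam * (q ^ k * (lam ^ r - 1) * lam ^ m) := by gcongr
        _ = _ := by ring
    · calc _ ≤ ∑ w ∈ words q (m + 1), (lam ^ r - 1) :=
            Finset.sum_le_sum fun w _ => sub_le_sub_left (one_le_pow₀ hlam.le) _
        _ = q ^ (m + 1) * (lam ^ r - 1) := by
            rw [Finset.sum_const, nsmul_eq_mul, card_words]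
        _ ≤ q ^ k * (lam ^ r - 1) := by
            gcongr
            omega
        _ ≤ _ := le_mul_of_one_le_right (by positivity) (one_le_pow₀ hlam.le)

/-- The words of length `m` without a `k`-periodic factor of length `r + k`. -/
def aperiodicWords (q k r m : ℕ) : Finset (List (Fin q)) :=
  {w ∈ words q m | periodRun k r w ≠ r}

theorem sum_aperiodicWords (m : ℕ) :
    ∑ w ∈ aperiodicWords q k r m, (lam ^ r - lam ^ periodRun k r w) =
      ∑ w ∈ words q m, (lam ^ r - lam ^ periodRun k r w) := by
  apply Finset.sum_filter_of_ne
  intro w _ h h'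
  simp [h'] at h

theorem pow_le_card_aperiodicWords (hr : 1 ≤ r) (hlam : 1 < lam)
    (hroot : lam ^ (r + 1) - q * lam ^ r + q - 1 = 0) (m : ℕ) :
    lam ^ m ≤ (aperiodicWords q k r m).card := by
  have h1 : 0 < lam ^ r - 1 := sub_pos.2 (one_lt_pow₀ hlam (by omega))
  refine le_of_mul_le_mul_right ((le_sum_potential (k := k) hlam hroot m).trans ?_) h1
  rw [← sum_aperiodicWords, ← nsmul_eq_mul]
  exact Finset.sum_le_card_nsmul _ _ _ fun w _ => sub_le_sub_left (one_le_pow₀ hlam.le) _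

theorem card_aperiodicWords_le (hq : 1 ≤ q) (hk : 1 ≤ k) (hlam : 1 < lam) (hr : 1 ≤ r)
    (hroot : lam ^ (r + 1) - q * lam ^ r + q - 1 = 0) (m : ℕ) :
    ((aperiodicWords q k r m).card : ℝ) ≤
      q ^ k * (lam ^ r - 1) / (lam ^ r - lam ^ (r - 1)) * lam ^ m := by
  have h1 : 0 < lam ^ r - lam ^ (r - 1) := sub_pos.2 (pow_lt_pow_right₀ hlam (by omega))
  rw [div_mul_eq_mul_div, le_div_iff₀ h1]
  refine le_trans ?_ (sum_potential_le hq hk hlam hroot m)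
  rw [← sum_aperiodicWords, ← nsmul_eq_mul]
  refine Finset.card_nsmul_le_sum _ _ _ fun w hw => ?_
  have h2 := (Finset.mem_filter.1 hw).2
  have h3 := periodRun_le k r w
  exact sub_le_sub_left (pow_le_pow_right₀ hlam.le (by omega)) _

end Potential

theorem range_nucleus_ofFn (q k ℓ n : ℕ) :
    (Set.range fun x : Fin n → Fin q => nucleus k ℓ (List.ofFn x)) =
      ↑((words q n).image fun w => nucleus k ℓ w.reverse) := by
  ext z
  simp only [Set.mem_range, Finset.coe_image, Set.mem_image, Finset.mem_coe, mem_words]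
  constructor
  · rintro ⟨x, rfl⟩
    exact ⟨(List.ofFn x).reverse, by simp, by simp⟩
  · rintro ⟨w, rfl, rfl⟩
    refine ⟨fun i => w.reverse.get (i.cast (by simp)), ?_⟩
    congr 1
    apply List.ext_getElem <;> simp

theorem mem_aperiodicWords {q k r m : ℕ} (hk : 1 ≤ k) (hr : 1 ≤ r) {w : List (Fin q)} :
    w ∈ aperiodicWords q k r m ↔ w.length = m ∧ ¬ HasPeriodicFactor k r w := by
  rw [aperiodicWords, Finset.mem_filter, mem_words, ne_eq, periodRun_eq_iff hk hr]

theorem nucleus_eq_of_not_hasPeriodicFactor {q k ℓ : ℕ} (hk : 2 ≤ k) (hl : 2 ≤ ℓ)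
    (hdvd : ℓ ∣ k) {x : List (Fin q)} (hx : ¬ HasPeriodicFactor k (k + ℓ - 1) x) :
    nucleus k ℓ x = kderiv k (readVec ℓ x) :=
  muk_eq_self _ fun _ hs => exists_ne_zero_of_not_hasPeriodicFactor hl hk hdvd hx hs

theorem card_aperiodicWords_le_card_nuclei {q k ℓ : ℕ} (hk : 2 ≤ k) (hl : 2 ≤ ℓ) (hdvd : ℓ ∣ k)
    (n : ℕ) : (aperiodicWords q k (k + ℓ - 1) n).card ≤
      ((words q n).image fun w => nucleus k ℓ w.reverse).card := by
  apply Finset.card_le_card_of_injOn (fun w => nucleus k ℓ w.reverse)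
  · intro w hw
    exact Finset.mem_image_of_mem _ (Finset.filter_subset _ _ hw)
  · intro w hw w' hw' h
    rw [Finset.mem_coe, mem_aperiodicWords (by omega) (by omega)] at hw hw'
    have key : ∀ {v : List (Fin q)}, ¬ HasPeriodicFactor k (k + ℓ - 1) v →
        ¬ HasPeriodicFactor k (k + ℓ - 1) v.reverse :=
      fun hv h => hv (by simpa using h.reverse)
    simp only [nucleus_eq_of_not_hasPeriodicFactor hk hl hdvd (key hw.2),
      nucleus_eq_of_not_hasPeriodicFactor hk hl hdvd (key hw'.2)] at h
    exact List.reverse_injective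
      (kderiv_readVec_injective (by omega) (by omega) (by simp [hw.1, hw'.1]) h)

theorem exists_aperiodic_nucleus_eq {q k ℓ : ℕ} (hk : 1 ≤ k) (hl : 1 ≤ ℓ) (x : List (Fin q)) :
    ∃ x' : List (Fin q), x'.length ≤ x.length ∧ ¬ HasPeriodicFactor k (k + ℓ - 1) x' ∧
      nucleus k ℓ x' = nucleus k ℓ x := by
  induction hn : x.length using Nat.strong_induction_on generalizing x with
  | _ n ih =>
    by_cases hx : HasPeriodicFactor k (k + ℓ - 1) x
    · obtain ⟨y, hy, hxy⟩ := exists_nucleus_eq_of_hasPeriodicFactor hl hx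
      obtain ⟨x', h1, h2, h3⟩ := ih y.length (by omega) y rfl
      exact ⟨x', by omega, h2, h3.trans hxy⟩
    · exact ⟨x, hn.le, hx, rfl⟩

theorem card_nuclei_le_sum_card_aperiodicWords {q k ℓ : ℕ} (hk : 1 ≤ k) (hl : 1 ≤ ℓ) (n : ℕ) :
    ((words q n).image fun w => nucleus k ℓ w.reverse).card ≤
      ∑ m ∈ Finset.range (n + 1), (aperiodicWords q k (k + ℓ - 1) m).card := by
  have hsub : ((words q n).image fun w => nucleus k ℓ w.reverse) ⊆
      (Finset.range (n + 1)).biUnion fun m =>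
        (aperiodicWords q k (k + ℓ - 1) m).image fun w => nucleus k ℓ w.reverse := by
    intro z hz
    obtain ⟨w, hw, rfl⟩ := Finset.mem_image.1 hz
    obtain ⟨x', h1, h2, h3⟩ := exists_aperiodic_nucleus_eq hk hl w.reverse
    rw [List.length_reverse, mem_words.1 hw] at h1
    simp only [Finset.mem_biUnion, Finset.mem_range, Finset.mem_image]
    refine ⟨x'.length, by omega, x'.reverse, ?_, by simpa using h3⟩
    rw [mem_aperiodicWords hk (by omega)]
    exact ⟨by simp, fun h => h2 (by simpa using h.reverse)⟩
  exact (Finset.card_le_card hsub).trans (Finset.card_biUnion_le.trans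
    (Finset.sum_le_sum fun m _ => Finset.card_image_le))

theorem tendsto_logb_div_of_pow_le {b lam C : ℝ} {u : ℕ → ℝ} (hb : 1 < b) (hlam : 0 < lam)
    (hlow : ∀ n, lam ^ n ≤ u n) (hupp : ∀ n, u n ≤ (n + 1) * C * lam ^ n) :
    Filter.Tendsto (fun n : ℕ => Real.logb b (u n) / n) Filter.atTop
      (nhds (Real.logb b lam)) := by
  have hC : 0 < C := by
    have h := (hlow 0).trans (hupp 0)
    simp at h
    linarith
  have hlog : Filter.Tendsto (fun n : ℕ => Real.log n / n) Filter.atTop (nhds 0) :=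
    Real.isLittleO_log_id_atTop.tendsto_div_nhds_zero.comp tendsto_natCast_atTop_atTop
  have hconst : Filter.Tendsto (fun n : ℕ => Real.logb b (2 * C) / n) Filter.atTop (nhds 0) :=
    tendsto_const_div_atTop_nhds_zero_nat _
  have hup : Filter.Tendsto
      (fun n : ℕ => Real.log n / n / Real.log b + Real.logb b (2 * C) / n + Real.logb b lam)
      Filter.atTop (nhds (Real.logb b lam)) := by
    simpa using ((hlog.div_const (Real.log b)).add hconst).add_const (Real.logb b lam)
  refine tendsto_of_tendsto_of_tendsto_of_le_of_le' tendsto_const_nhds hup ?_ ?_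
  · filter_upwards [Filter.eventually_ge_atTop 1] with n hn
    have hn' : (0 : ℝ) < n := by exact_mod_cast hn
    rw [le_div_iff₀ hn', mul_comm, ← Real.logb_pow]
    exact Real.logb_le_logb_of_le hb (by positivity) (hlow n)
  · filter_upwards [Filter.eventually_ge_atTop 1] with n hn
    have hn' : (1 : ℝ) ≤ n := by exact_mod_cast hn
    have hn0 : (0 : ℝ) < n := by linarith
    have h1 : u n ≤ n * (2 * C) * lam ^ n := by
      refine (hupp n).trans ?_
      gcongr ?_ * _
      nlinarith
    have h2 := Real.logb_le_logb_of_le hb (lt_of_lt_of_le (by positivity) (hlow n)) h1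
    rw [Real.logb_mul (by positivity) (by positivity), Real.logb_mul (by positivity)
      (by positivity), Real.logb_pow] at h2
    rw [div_le_iff₀ hn0]
    refine h2.trans (le_of_eq ?_)
    have : Real.log b ≠ 0 := (Real.log_pos hb).ne'
    rw [Real.logb, Real.logb, Real.logb]
    field_simp

/-- if `ℓ ∣ k`, then
`(1/n)·log_q |{N_{k,ℓ}(x) : x ∈ Z_q^n}| → log_q λ_{k+ℓ−2,q}` as `n → ∞`. -/
theorem stmt_13 (q k ℓ : ℕ) (hq : 2 ≤ q) (hk : 2 ≤ k) (hl : 2 ≤ ℓ) (hdvd : ℓ ∣ k) :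
    Filter.Tendsto
      (fun n : ℕ =>
        Real.logb q
            (Set.ncard (Set.range fun x : Fin n → Fin q => nucleus k ℓ (List.ofFn x))) / n)
      Filter.atTop (nhds (Real.logb q (lambdaRoot (k + ℓ - 2) q))) := by
  set r := k + ℓ - 1 with hr
  obtain ⟨hlam, hroot⟩ := lambdaRoot_spec (m := k + ℓ - 2) (by omega) hq
  rw [show k + ℓ - 2 + 2 = r + 1 by omega, show k + ℓ - 2 + 1 = r by omega] at hroot
  set lam := lambdaRoot (k + ℓ - 2) q
  have hq1 : (1 : ℝ) < q := by exact_mod_cast hq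
  have hlow := pow_le_card_aperiodicWords (k := k) (by omega : 1 ≤ r) hlam hroot
  have hupp := card_aperiodicWords_le (by omega : 1 ≤ q) (by omega : 1 ≤ k) hlam
    (by omega : 1 ≤ r) hroot
  set C : ℝ := q ^ k * (lam ^ r - 1) / (lam ^ r - lam ^ (r - 1))
  have hC : 0 ≤ C := by
    have h := (hlow 0).trans (hupp 0)
    simp only [pow_zero, mul_one] at h
    linarith
  refine tendsto_logb_div_of_pow_le (C := C) hq1 (by linarith) (fun n => ?_) fun n => ?_
  · rw [range_nucleus_ofFn, Set.ncard_coe_finset]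
    exact (hlow n).trans (by exact_mod_cast card_aperiodicWords_le_card_nuclei hk hl hdvd n)
  · rw [range_nucleus_ofFn, Set.ncard_coe_finset]
    calc _ ≤ ∑ m ∈ Finset.range (n + 1), ((aperiodicWords q k r m).card : ℝ) := by
          exact_mod_cast card_nuclei_le_sum_card_aperiodicWords (by omega) (by omega) n
      _ ≤ ∑ m ∈ Finset.range (n + 1), C * lam ^ n := by
          refine Finset.sum_le_sum fun m hm => (hupp m).trans ?_
          have : m ≤ n := by simpa [Nat.lt_succ_iff] using hm
          gcongr
          exact hlam.le
      _ = _ := by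
          rw [Finset.sum_const, Finset.card_range, nsmul_eq_mul]
          push_cast
          ring
end

section
/- Let k, ℓ ≥ 2 be integers with ℓ > k, and let q ≥ 2 be an integer with q^{2k−1} ≥ k!·(16k+8ℓ−16). Set c = (1 − √(1 − k!·(16k+8ℓ−16)/q^{2k−1})) / (8k+4ℓ−8). Then for every n ≥ 2k+ℓ−1, the number of x ∈ Z_q^n such that Δ_k(R_ℓ(x)) does not contain the factor 0^k is at least q^n·(1−c)^{n−2k−ℓ+2}; consequently liminf_{n→∞} (1/n)·log_q |{N_{k,ℓ}(x) : x ∈ Z_q^n}| ≥ 1 − log_q(1/(1−c)). -/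
/-! ### Nuclei of words without zero blocks -/

lemma zeroRuns_cons_zero {G : Type*} [Zero G] [DecidableEq G] (y : List G) :
    zeroRuns ((0 : G) :: y) = (zeroRuns y).modifyHead (· + 1) := by
  unfold zeroRuns
  rw [List.splitOnP_cons_eq_if_modifyHead]
  cases List.splitOnP (fun a : G => decide (a ≠ 0)) y <;> simp

lemma zeroRuns_cons_of_ne {G : Type*} [Zero G] [DecidableEq G] {a : G} (ha : a ≠ 0)
    (y : List G) : zeroRuns (a :: y) = 0 :: zeroRuns y := by
  unfold zeroRuns
  rw [List.splitOnP_cons_eq_if_modifyHead]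
  simp [ha]

/-- The first zero run is a prefix, and the remaining ones are factors. -/
lemma exists_zeroRuns_eq_cons {G : Type*} [Zero G] [DecidableEq G] (y : List G) :
    ∃ m ms, zeroRuns y = m :: ms ∧ List.replicate m (0 : G) <+: y ∧
      ∀ m' ∈ ms, List.replicate m' (0 : G) <:+: y := by
  induction y with
  | nil => exact ⟨0, [], by simp [zeroRuns], by simp, by simp⟩
  | cons a y ih =>
    obtain ⟨m, ms, h, hp, hi⟩ := ih
    by_cases ha : a = 0
    · subst ha
      refine ⟨m + 1, ms, by rw [zeroRuns_cons_zero, h]; rfl, ?_, fun m' hm' => ?_⟩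
      · rw [List.replicate_succ]
        exact (List.prefix_cons_inj 0).2 hp
      · exact List.infix_cons (hi m' hm')
    · refine ⟨0, m :: ms, by rw [zeroRuns_cons_of_ne ha, h], by simp, fun m' hm' => ?_⟩
      rcases List.mem_cons.1 hm' with rfl | hm'
      · exact List.infix_cons hp.isInfix
      · exact List.infix_cons (hi m' hm')

lemma assemble_zeroRuns {G : Type*} [Zero G] [DecidableEq G] (y : List G) :
    assemble (zeroRuns y) (y.filter fun a => decide (a ≠ 0)) = y := by
  induction y with
  | nil => simp [zeroRuns, assemble]
  | cons a y ih =>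
    by_cases ha : a = 0
    · subst ha
      obtain ⟨m, ms, h, -, -⟩ := exists_zeroRuns_eq_cons y
      rw [h] at ih
      rw [zeroRuns_cons_zero, h, List.filter_cons_of_neg (by simp)]
      conv_rhs => rw [← ih]
      cases List.filter (fun a : G => decide (a ≠ 0)) y <;>
        simp [assemble, List.replicate_succ]
    · rw [zeroRuns_cons_of_ne ha, List.filter_cons_of_pos (by simp [ha])]
      simpa [assemble] using ih

lemma hasZeroBlock_of_replicate_infix {G : Type*} [Zero G] {k m : ℕ} {y : List G}
    (hkm : k ≤ m) (h : List.replicate m (0 : G) <:+: y) : HasZeroBlock k y := by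
  obtain ⟨s, t, rfl⟩ := h
  refine ⟨s.length, by simp; omega, ?_⟩
  rw [List.append_assoc, List.drop_left, List.take_append_of_le_length (by simpa using hkm),
    List.take_replicate, min_eq_left hkm]

lemma muk_eq_self_s15 {G : Type*} [Zero G] [DecidableEq G] {k : ℕ} {y : List G}
    (h : ¬HasZeroBlock k y) : muk k y = y := by
  have hlt : ∀ m ∈ zeroRuns y, m < k := by
    intro m hm
    by_contra! hkm
    obtain ⟨m₀, ms, hr, hp, hi⟩ := exists_zeroRuns_eq_cons y
    rw [hr] at hm
    rcases List.mem_cons.1 hm with rfl | hm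
    · exact h (hasZeroBlock_of_replicate_infix hkm hp.isInfix)
    · exact h (hasZeroBlock_of_replicate_infix hkm (hi m hm))
  have hmod : (zeroRuns y).map (fun m => m % k) = zeroRuns y :=
    (List.map_congr_left (g := id) fun m hm => Nat.mod_eq_of_lt (hlt m hm)).trans
      (List.map_id _)
  rw [muk, hmod, assemble_zeroRuns]

/-! ### Compositions, read vectors and derivatives -/

lemma comp_eq_comp_iff {q : ℕ} {v w : List (Fin q)} : comp v = comp w ↔ v.Perm w := by
  rw [List.perm_iff_count]
  simp [comp, funext_iff]

lemma eq_of_append_singleton_perm {α : Type*} {s : List α} {a b : α}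
    (h : (s ++ [a]).Perm (s ++ [b])) : a = b := by
  simpa using (List.perm_append_left_iff s).1 h

@[simp] lemma length_readVec {q : ℕ} (ℓ : ℕ) (x : List (Fin q)) :
    (readVec ℓ x).length = x.length + ℓ - 1 := by
  simp [readVec]

@[simp] lemma length_kderiv {G : Type*} [AddCommGroup G] (k : ℕ) (y : List G) :
    (kderiv k y).length = y.length := by
  simp [kderiv]

lemma kderiv_inj {G : Type*} [AddCommGroup G] {k : ℕ} (hk : 0 < k) {y z : List G}
    (h : kderiv k y = kderiv k z) : y = z := by
  have hlen : y.length = z.length := by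
    simpa using congrArg List.length h
  have key : ∀ i, i < y.length → y.getD i 0 = z.getD i 0 := by
    intro i
    induction i using Nat.strong_induction_on with
    | _ i ih =>
      intro hi
      have hget := congrArg (fun l => l.getD i 0) h
      simp only [kderiv, List.getD_eq_getElem?_getD, List.getElem?_map] at hget
      rw [List.getElem?_range hi, List.getElem?_range (hlen ▸ hi)] at hget
      simp only [Option.map_some, Option.getD_some, ← List.getD_eq_getElem?_getD] at hget
      split_ifs at hget with hki
      · rw [ih (i - k) (by omega) (by omega)] at hget
        exact sub_left_injective hget
      · simpa using hget
  refine List.ext_getElem hlen fun i h₁ h₂ => ?_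
  rw [← List.getD_eq_getElem _ 0 h₁, ← List.getD_eq_getElem _ 0 h₂]
  exact key i h₁

lemma readVec_inj {q ℓ : ℕ} (hℓ : 0 < ℓ) {x z : List (Fin q)} (hlen : x.length = z.length)
    (h : readVec ℓ x = readVec ℓ z) : x = z := by
  have key : ∀ p, p ≤ x.length → x.take p = z.take p := by
    intro p
    induction p with
    | zero => simp
    | succ p ih =>
      intro hp
      have ih := ih (by omega)
      have hget := congrArg (fun l => l.getD p 0) h
      simp only [readVec, List.getD_eq_getElem?_getD, List.getElem?_map] at hget
      rw [List.getElem?_range (by omega), List.getElem?_range (by omega)] at hget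
      simp only [Option.map_some, Option.getD_some, comp_eq_comp_iff] at hget
      rw [List.take_succ_eq_append_getElem (by omega : p < x.length),
        List.take_succ_eq_append_getElem (by omega : p < z.length), ih] at hget ⊢
      rw [List.drop_append_of_le_length (by simp; omega),
        List.drop_append_of_le_length (by simp; omega)] at hget
      rw [eq_of_append_singleton_perm hget]
  have := key x.length le_rfl
  rwa [List.take_length, hlen, List.take_length] at this

/-- The windows of `w` of length `k` at positions `t` and `ℓ + t` agree up to permutation
for all `t < k`. -/
def ShiftPeriodic {α : Type*} (k ℓ : ℕ) (w : List α) : Prop :=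
  ∀ t < k, ((w.drop (ℓ + t)).take k).Perm ((w.drop t).take k)

lemma drop_take_perm_of_shift {α : Type*} {k ℓ a : ℕ} (hkl : k < ℓ) {x : List α}
    (hx : a + ℓ + k ≤ x.length)
    (h : ((x.drop (a + k)).take ℓ).Perm ((x.drop a).take ℓ)) :
    ((x.drop (a + ℓ)).take k).Perm ((x.drop a).take k) := by
  obtain ⟨d, rfl⟩ := Nat.exists_eq_add_of_lt hkl
  have e₁ : (x.drop (a + k)).take (k + d + 1)
      = (x.drop (a + k)).take (d + 1) ++ (x.drop (a + (k + d + 1))).take k := by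
    rw [show k + d + 1 = (d + 1) + k by omega, List.take_add, List.drop_drop,
      show a + k + (d + 1) = a + (d + 1 + k) by omega]
  have e₂ : (x.drop a).take (k + d + 1)
      = (x.drop a).take k ++ (x.drop (a + k)).take (d + 1) := by
    rw [add_assoc, List.take_add, List.drop_drop]
  rw [e₁, e₂] at h
  exact (List.perm_append_left_iff _).1 (h.trans List.perm_append_comm)

lemma exists_shiftPeriodic_of_hasZeroBlock {q k ℓ : ℕ} (hk : 0 < k) (hkl : k < ℓ)
    {x : List (Fin q)} (hn : 2 * k + ℓ - 1 ≤ x.length)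
    (h : HasZeroBlock k (kderiv k (readVec ℓ x))) :
    ∃ i, i + (ℓ + 2 * k - 1) ≤ x.length ∧
      ShiftPeriodic k ℓ ((x.drop i).take (ℓ + 2 * k - 1)) := by
  obtain ⟨j, hj, hz⟩ := h
  simp only [length_kderiv, length_readVec] at hj
  have key : ∀ t < k, ℓ + k ≤ j + t + 1 ∧ j + t < x.length ∧
      ((x.drop (j + t + 1 - k)).take k).Perm ((x.drop (j + t + 1 - k - ℓ)).take k) := by
    intro t ht
    have hget := congrArg (fun l => l.getD t 0) hz
    simp only [kderiv, List.getD_eq_getElem?_getD, List.getElem?_take, ht, if_true,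
      List.getElem?_drop, List.getElem?_map, List.getElem?_replicate, length_readVec] at hget
    rw [List.getElem?_range (by omega)] at hget
    simp only [readVec, List.getElem?_map, Option.map_some, Option.getD_some] at hget
    rw [List.getElem?_range (by omega)] at hget
    simp only [Option.map_some, Option.getD_some] at hget
    split_ifs at hget with hkj
    · rw [List.getElem?_range (by omega)] at hget
      simp only [Option.map_some, Option.getD_some, sub_eq_zero, comp_eq_comp_iff] at hget
      have hlen := hget.length_eq
      simp only [List.length_drop, List.length_take] at hlen
      have h₁ : j + t < x.length := by omega
      have h₂ : ℓ + k ≤ j + t + 1 := by omega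
      refine ⟨h₂, h₁, ?_⟩
      obtain ⟨a, ha⟩ := Nat.exists_eq_add_of_le h₂
      rw [List.drop_take, List.drop_take,
        show j + t + 1 - (j + t + 1 - ℓ) = ℓ by omega,
        show j + t - k + 1 - (j + t - k + 1 - ℓ) = ℓ by omega,
        show j + t + 1 - ℓ = a + k by omega, show j + t - k + 1 - ℓ = a by omega] at hget
      rw [show j + t + 1 - k = a + ℓ by omega, show a + ℓ - ℓ = a by omega]
      exact drop_take_perm_of_shift hkl (by omega) hget
    · rw [sub_zero, show (0 : Fin q → ℤ) = comp [] by ext; simp [comp],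
        comp_eq_comp_iff] at hget
      have hlen := hget.length_eq
      simp only [List.length_drop, List.length_take, List.length_nil] at hlen
      omega
  have h₀ := key 0 hk
  have h₁ := key (k - 1) (by omega)
  refine ⟨j + 1 - ℓ - k, by omega, fun t ht => ?_⟩
  have h₂ := (key t ht).2.2
  rw [List.drop_take, List.drop_take, List.take_take, List.take_take, List.drop_drop,
    List.drop_drop, min_eq_left (by omega), min_eq_left (by omega)]
  rwa [show j + t + 1 - k = j + 1 - ℓ - k + (ℓ + t) by omega,
    show j + 1 - ℓ - k + (ℓ + t) - ℓ = j + 1 - ℓ - k + t by omega] at h₂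

/-! ### Counting shift-periodic words -/

lemma finite_setOf_length_and {α : Type*} [Finite α] (n : ℕ) (P : List α → Prop) :
    {w : List α | w.length = n ∧ P w}.Finite :=
  (List.finite_length_eq α n).subset fun _ h => h.1

lemma ncard_length_eq (α : Type*) [Fintype α] (n : ℕ) :
    {w : List α | w.length = n}.ncard = Fintype.card α ^ n := by
  rw [← card_vector (α := α) n, ← Nat.card_eq_fintype_card]
  rfl

lemma ShiftPeriodic.take_inj {α : Type*} {k ℓ : ℕ} (hkl : k < ℓ)
    {v w : List α} (hv : ShiftPeriodic k ℓ v) (hw : ShiftPeriodic k ℓ w)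
    (hvl : v.length = ℓ + 2 * k - 1) (hwl : w.length = ℓ + 2 * k - 1)
    (h : v.take (ℓ + k) = w.take (ℓ + k)) : v = w := by
  have key : ∀ t, t < k → v.take (ℓ + k + t) = w.take (ℓ + k + t) := by
    intro t
    induction t with
    | zero => exact fun _ => h
    | succ t ih =>
      intro ht
      have ih := ih (by omega)
      have hp : ((v.drop (ℓ + (t + 1))).take k).Perm ((w.drop (ℓ + (t + 1))).take k) := by
        refine (hv _ ht).trans (.trans (.of_eq ?_) (hw _ ht).symm)
        have := congrArg (fun l => (l.drop (t + 1)).take k) ih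
        simpa only [List.drop_take, List.take_take,
          min_eq_left (show k ≤ ℓ + k + t - (t + 1) by omega)] using this
      have hs : ∀ u : List α, (u.drop (ℓ + (t + 1))).take k
          = (u.take (ℓ + k + (t + 1))).drop (ℓ + (t + 1)) := fun u => by
        rw [List.drop_take, show ℓ + k + (t + 1) - (ℓ + (t + 1)) = k by omega]
      rw [hs, hs, ← add_assoc (ℓ + k)] at hp
      rw [← add_assoc (ℓ + k)]
      rw [List.take_succ_eq_append_getElem (by omega : ℓ + k + t < v.length),
        List.take_succ_eq_append_getElem (by omega : ℓ + k + t < w.length), ih] at hp ⊢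
      rw [List.drop_append_of_le_length (by simp; omega),
        List.drop_append_of_le_length (by simp; omega)] at hp
      rw [eq_of_append_singleton_perm hp]
  rcases Nat.eq_zero_or_pos k with rfl | hk
  · rwa [List.take_of_length_le (by omega), List.take_of_length_le (by omega)] at h
  · have := key (k - 1) (by omega)
    rwa [List.take_of_length_le (by omega), List.take_of_length_le (by omega)] at this

lemma ncard_shiftPeriodic_le {α : Type*} [Fintype α] {k ℓ : ℕ} (hk : 0 < k) (hkl : k < ℓ) :
    {w : List α | w.length = ℓ + 2 * k - 1 ∧ ShiftPeriodic k ℓ w}.ncard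
      ≤ k.factorial * Fintype.card α ^ ℓ := by
  classical
  let U : Finset (List α) := (List.finite_length_eq α ℓ).toFinset
  let T : Finset (List α) :=
    U.biUnion fun u => (u.take k).permutations.toFinset.image (u ++ ·)
  have hT : T.card ≤ Fintype.card α ^ ℓ * k.factorial := by
    have hU : U.card = Fintype.card α ^ ℓ := by
      rw [← ncard_length_eq, Set.ncard_eq_toFinset_card _ (List.finite_length_eq α ℓ)]
    rw [← hU]
    refine Finset.card_biUnion_le_card_mul _ _ _ fun u hu => ?_
    have hu : u.length = ℓ := by simpa [U] using hu
    refine Finset.card_image_le.trans ((List.toFinset_card_le _).trans ?_)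
    rw [List.length_permutations, List.length_take, min_eq_left (by omega)]
  rw [Nat.mul_comm k.factorial]
  refine le_trans ?_ hT
  rw [← Set.ncard_coe_finset]
  refine Set.ncard_le_ncard_of_injOn (fun w => w.take (ℓ + k)) ?_ ?_ T.finite_toSet
  · rintro w ⟨hlen, hw⟩
    simp only [T, Finset.coe_biUnion, Set.mem_iUnion, Finset.mem_coe, Finset.mem_image,
      List.mem_toFinset, List.mem_permutations]
    refine ⟨w.take ℓ, by simp [U]; omega, (w.drop ℓ).take k, ?_, List.take_add.symm⟩
    rw [List.take_take, min_eq_left hkl.le]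
    simpa using hw 0 hk
  · rintro v ⟨hvl, hv⟩ w ⟨hwl, hw⟩ h
    exact hv.take_inj hkl hw hvl hwl h

/-! ### Words avoiding a set of factors of fixed length -/

/-- The words of length `n` none of whose factors of length `L` satisfies `B`. -/
def avoiding {α : Type*} (B : List α → Prop) (L n : ℕ) : Set (List α) :=
  {w | w.length = n ∧ ∀ i, i + L ≤ n → ¬B ((w.drop i).take L)}

lemma finite_avoiding {α : Type*} [Finite α] (B : List α → Prop) (L n : ℕ) :
    (avoiding B L n).Finite :=
  finite_setOf_length_and n _

lemma ncard_image_append_singleton {α : Type*} [Fintype α] (S : Set (List α)) :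
    ((fun p : List α × α => p.1 ++ [p.2]) '' S ×ˢ Set.univ).ncard
      = Fintype.card α * S.ncard := by
  rw [Set.ncard_image_of_injective, Set.ncard_prod, Set.ncard_univ, Nat.card_eq_fintype_card,
    mul_comm]
  rintro ⟨v, a⟩ ⟨w, b⟩ h
  simpa using h

lemma ncard_avoiding_succ_of_lt {α : Type*} [Fintype α] (B : List α → Prop) {L n : ℕ}
    (hn : n + 1 < L) :
    Fintype.card α * (avoiding B L n).ncard ≤ (avoiding B L (n + 1)).ncard := by
  rw [← ncard_image_append_singleton]
  refine Set.ncard_le_ncard ?_ (finite_avoiding B L _)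
  rintro _ ⟨⟨w, a⟩, ⟨⟨hw, -⟩, -⟩, rfl⟩
  exact ⟨by simp [hw], fun i hi => by omega⟩

lemma ncard_avoiding_succ_of_le {α : Type*} [Fintype α] (B : List α → Prop) {L n : ℕ}
    (hL : 0 < L) (hn : L ≤ n + 1) :
    Fintype.card α * (avoiding B L n).ncard ≤ (avoiding B L (n + 1)).ncard +
      (avoiding B L (n + 1 - L)).ncard * {w : List α | w.length = L ∧ B w}.ncard := by
  have hfin := (finite_avoiding B L (n + 1 - L)).prod (finite_setOf_length_and L B)
  rw [← ncard_image_append_singleton, ← Set.ncard_prod]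
  refine (Set.ncard_le_ncard (t := avoiding B L (n + 1) ∪
    (fun p : List α × List α => p.1 ++ p.2) ''
      (avoiding B L (n + 1 - L) ×ˢ {w : List α | w.length = L ∧ B w})) ?_ ?_).trans
    ((Set.ncard_union_le _ _).trans (Nat.add_le_add_left (Set.ncard_image_le hfin) _))
  · rintro _ ⟨⟨w, a⟩, ⟨⟨hw, hB⟩, -⟩, rfl⟩
    simp only at hw hB ⊢
    by_cases hlast : B ((w ++ [a]).drop (n + 1 - L))
    · refine Or.inr ⟨((w ++ [a]).take (n + 1 - L), (w ++ [a]).drop (n + 1 - L)),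
        ⟨⟨by simp; omega, fun i hi => ?_⟩, by simp; omega, hlast⟩, List.take_append_drop _ _⟩
      simp only
      rw [List.take_append_of_le_length (by omega), List.drop_take, List.take_take,
        min_eq_left (by omega)]
      exact hB i (by omega)
    · refine Or.inl ⟨by simp [hw], fun i hi => ?_⟩
      rcases Nat.lt_or_ge n (i + L) with h | h
      · obtain rfl : i = n + 1 - L := by omega
        rwa [List.take_of_length_le (by simp; omega)]
      · rw [List.drop_append_of_le_length (by omega),
          List.take_append_of_le_length (by simp; omega)]
        exact hB i h
  · exact (finite_avoiding B L _).union (hfin.image _)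

/-- If few words of length `L` satisfy `B`, then the number of words avoiding `B` grows
by a factor of at least `q (1 - c)` with every letter. -/
lemma mul_ncard_avoiding_le {α : Type*} [Fintype α] (B : List α → Prop) {L : ℕ} (hL : 0 < L)
    {c : ℝ} (hc₀ : 0 ≤ c) (hc₁ : c ≤ 1)
    (hB : ({w : List α | w.length = L ∧ B w}.ncard : ℝ) ≤
      Fintype.card α * c * (Fintype.card α * (1 - c)) ^ (L - 1)) (n : ℕ) :
    Fintype.card α * (1 - c) * ((avoiding B L n).ncard : ℝ) ≤ (avoiding B L (n + 1)).ncard := by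
  have hq : (0 : ℝ) ≤ Fintype.card α := Nat.cast_nonneg _
  have hr : 0 ≤ Fintype.card α * (1 - c) := mul_nonneg hq (by linarith)
  induction n using Nat.strong_induction_on with
  | _ n ih =>
    have hG : (0 : ℝ) ≤ (avoiding B L n).ncard := Nat.cast_nonneg _
    rcases Nat.lt_or_ge (n + 1) L with h | h
    · have hs : (Fintype.card α * (avoiding B L n).ncard : ℝ) ≤ (avoiding B L (n + 1)).ncard :=
        mod_cast ncard_avoiding_succ_of_lt B h
      have := mul_nonneg (mul_nonneg hq hc₀) hG
      linarith
    · have hs : (Fintype.card α * (avoiding B L n).ncard : ℝ) ≤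
          (avoiding B L (n + 1)).ncard + (avoiding B L (n + 1 - L)).ncard *
            {w : List α | w.length = L ∧ B w}.ncard :=
        mod_cast ncard_avoiding_succ_of_le B hL h
      have hpow : ∀ j, n + 1 - L + j ≤ n →
          (Fintype.card α * (1 - c)) ^ j * ((avoiding B L (n + 1 - L)).ncard : ℝ) ≤
            (avoiding B L (n + 1 - L + j)).ncard := by
        intro j
        induction j with
        | zero => simp
        | succ j ihj =>
          intro hj
          refine le_trans ?_ (ih (n + 1 - L + j) (by omega))
          rw [pow_succ', mul_assoc]
          exact mul_le_mul_of_nonneg_left (ihj (by omega)) hr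
      have hlast := hpow (L - 1) (by omega)
      rw [show n + 1 - L + (L - 1) = n by omega] at hlast
      have h₁ := mul_le_mul_of_nonneg_left hB
        (Nat.cast_nonneg (α := ℝ) (avoiding B L (n + 1 - L)).ncard)
      have h₂ := mul_le_mul_of_nonneg_left hlast (mul_nonneg hq hc₀)
      linarith

lemma le_ncard_avoiding {α : Type*} [Fintype α] (B : List α → Prop) {L : ℕ} (hL : 0 < L)
    {c : ℝ} (hc₀ : 0 ≤ c) (hc₁ : c ≤ 1)
    (hB : ({w : List α | w.length = L ∧ B w}.ncard : ℝ) ≤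
      Fintype.card α * c * (Fintype.card α * (1 - c)) ^ (L - 1)) {n : ℕ} (hn : L - 1 ≤ n) :
    (Fintype.card α : ℝ) ^ n * (1 - c) ^ (n - (L - 1)) ≤ (avoiding B L n).ncard := by
  have hr : 0 ≤ Fintype.card α * (1 - c) := mul_nonneg (Nat.cast_nonneg _) (by linarith)
  have hshort : ∀ j, j < L → Fintype.card α ^ j ≤ (avoiding B L j).ncard := by
    intro j
    induction j with
    | zero =>
      intro _
      rw [pow_zero, Nat.one_le_iff_ne_zero]
      exact Set.ncard_ne_zero_of_mem (a := [])
        ⟨rfl, fun i hi => by omega⟩ (finite_avoiding B L 0)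
    | succ j ih =>
      intro hj
      rw [pow_succ']
      exact (Nat.mul_le_mul_left _ (ih (by omega))).trans (ncard_avoiding_succ_of_lt B hj)
  obtain ⟨m, rfl⟩ := Nat.exists_eq_add_of_le hn
  rw [show L - 1 + m - (L - 1) = m by omega]
  clear hn
  induction m with
  | zero => simpa using (mod_cast hshort (L - 1) (by omega) :
      (Fintype.card α : ℝ) ^ (L - 1) ≤ (avoiding B L (L - 1)).ncard)
  | succ m ih =>
    refine le_trans (le_of_eq ?_) ((mul_le_mul_of_nonneg_left ih hr).trans
      (mul_ncard_avoiding_le B hL hc₀ hc₁ hB (L - 1 + m)))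
    ring

/-! ### Counting nuclei -/

/-- The smaller root `c` of `D c² - c + P = 0` satisfies the local lemma condition. -/
lemma smaller_root_bounds {D P c : ℝ} (hD : 1 ≤ D) (hP : 0 ≤ P) (hDP : 4 * D * P ≤ 1)
    (hc : c = (1 - √(1 - 4 * D * P)) / (2 * D)) :
    0 ≤ c ∧ c ≤ 1 / 2 ∧ P = c * (1 - D * c) := by
  have hs := Real.sq_sqrt (show 0 ≤ 1 - 4 * D * P by linarith)
  have hs₀ := Real.sqrt_nonneg (1 - 4 * D * P)
  have hs₁ : √(1 - 4 * D * P) ≤ 1 :=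
    Real.sqrt_le_one.2 (by nlinarith)
  set s := √(1 - 4 * D * P)
  refine ⟨hc ▸ div_nonneg (by linarith) (by linarith), ?_, ?_⟩
  · rw [hc, div_le_iff₀ (by linarith)]
    linarith
  · rw [hc]
    field_simp
    nlinarith

lemma ncard_shiftPeriodic_le_of_root {q k ℓ : ℕ} (hk : 2 ≤ k) (hkl : k < ℓ) (hq : 2 ≤ q)
    {c : ℝ} (hc₀ : 0 ≤ c) (hc₁ : c ≤ 1)
    (hP : (k.factorial : ℝ) / (q : ℝ) ^ (2 * k - 1)
      = c * (1 - (4 * (k : ℝ) + 2 * ℓ - 4) * c)) :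
    ({w : List (Fin q) | w.length = ℓ + 2 * k - 1 ∧ ShiftPeriodic k ℓ w}.ncard : ℝ) ≤
      Fintype.card (Fin q) * c *
        (Fintype.card (Fin q) * (1 - c)) ^ (ℓ + 2 * k - 1 - 1) := by
  have hq₀ : (0 : ℝ) < q := by positivity
  have hcount : ({w : List (Fin q) | w.length = ℓ + 2 * k - 1 ∧
      ShiftPeriodic k ℓ w}.ncard : ℝ) ≤ k.factorial * (q : ℝ) ^ ℓ := by
    have := ncard_shiftPeriodic_le (α := Fin q) (k := k) (ℓ := ℓ) (by omega) hkl
    rw [Fintype.card_fin] at this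
    exact_mod_cast this
  refine hcount.trans ?_
  rw [Fintype.card_fin]
  have hk2 : (2 : ℝ) ≤ k := by exact_mod_cast hk
  have hℓ0 : (0 : ℝ) ≤ ℓ := Nat.cast_nonneg _
  have hbern : 1 - (4 * (k : ℝ) + 2 * ℓ - 4) * c ≤ (1 - c) ^ (ℓ + 2 * k - 1 - 1) := by
    have h := one_add_mul_le_pow (show (-2 : ℝ) ≤ -c by linarith) (ℓ + 2 * k - 1 - 1)
    have hcast : ((ℓ + 2 * k - 1 - 1 : ℕ) : ℝ) = ℓ + 2 * k - 2 := by
      rw [show ℓ + 2 * k - 1 - 1 = ℓ + 2 * k - 2 by omega, Nat.cast_sub (by omega)]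
      push_cast
      ring
    rw [hcast, ← sub_eq_add_neg] at h
    nlinarith
  have hPle : (k.factorial : ℝ) ≤
      c * (1 - c) ^ (ℓ + 2 * k - 1 - 1) * (q : ℝ) ^ (2 * k - 1) := by
    rw [← div_le_iff₀ (by positivity), hP]
    exact mul_le_mul_of_nonneg_left hbern hc₀
  calc (k.factorial : ℝ) * (q : ℝ) ^ ℓ
      ≤ c * (1 - c) ^ (ℓ + 2 * k - 1 - 1) * (q : ℝ) ^ (2 * k - 1) * (q : ℝ) ^ ℓ :=
        mul_le_mul_of_nonneg_right hPle (by positivity)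
    _ = c * (1 - c) ^ (ℓ + 2 * k - 1 - 1) * (q : ℝ) ^ ((ℓ + 2 * k - 1 - 1) + 1) := by
        rw [mul_assoc, ← pow_add]
        congr 2
        omega
    _ = _ := by
        rw [mul_pow, pow_succ]
        ring

lemma ncard_avoiding_le_card_not_hasZeroBlock {q k ℓ n : ℕ} (hk : 0 < k) (hkl : k < ℓ)
    (hn : 2 * k + ℓ - 1 ≤ n) :
    (avoiding (α := Fin q) (ShiftPeriodic k ℓ) (ℓ + 2 * k - 1) n).ncard ≤
      Nat.card {x : Fin n → Fin q //
        ¬HasZeroBlock k (kderiv k (readVec ℓ (List.ofFn x)))} := by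
  change _ ≤ Set.ncard {x : Fin n → Fin q |
    ¬HasZeroBlock k (kderiv k (readVec ℓ (List.ofFn x)))}
  rw [← Set.ncard_image_of_injective _ (List.ofFn_injective (α := Fin q) (n := n))]
  refine Set.ncard_le_ncard ?_ (Set.toFinite _)
  rintro w ⟨rfl, hw⟩
  refine ⟨w.get, fun h => ?_, List.ofFn_get w⟩
  rw [List.ofFn_get] at h
  obtain ⟨i, hi, hB⟩ := exists_shiftPeriodic_of_hasZeroBlock hk hkl hn h
  exact hw i hi hB

lemma card_not_hasZeroBlock_le_ncard_nucleus {q k ℓ n : ℕ} (hk : 0 < k) (hℓ : 0 < ℓ) :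
    Nat.card {x : Fin n → Fin q // ¬HasZeroBlock k (kderiv k (readVec ℓ (List.ofFn x)))} ≤
      (Set.range fun x : Fin n → Fin q => nucleus k ℓ (List.ofFn x)).ncard := by
  change Set.ncard {x : Fin n → Fin q |
    ¬HasZeroBlock k (kderiv k (readVec ℓ (List.ofFn x)))} ≤ _
  refine Set.ncard_le_ncard_of_injOn (fun x => nucleus k ℓ (List.ofFn x))
    (fun x _ => ⟨x, rfl⟩) ?_ (Set.finite_range _)
  intro x hx y hy h
  simp only [nucleus] at h
  rw [muk_eq_self_s15 hx, muk_eq_self_s15 hy] at h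
  exact List.ofFn_injective (readVec_inj hℓ (by simp) (kderiv_inj hk h))

lemma ncard_range_nucleus_le (q k ℓ n : ℕ) :
    (Set.range fun x : Fin n → Fin q => nucleus k ℓ (List.ofFn x)).ncard ≤ q ^ n := by
  rw [← Set.image_univ]
  refine (Set.ncard_image_le Set.finite_univ).trans ?_
  simp [Set.ncard_univ]

/-- Lovász Local Lemma bound, case `ℓ > k`. -/
theorem stmt_15 (q k ℓ : ℕ) (hk : 2 ≤ k) (hl : 2 ≤ ℓ) (hkl : k < ℓ) (hq : 2 ≤ q)
    (hbig : (Nat.factorial k : ℝ) * (16 * (k : ℝ) + 8 * (ℓ : ℝ) - 16) ≤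
      (q : ℝ) ^ (2 * k - 1))
    (c : ℝ)
    (hc : c = (1 - Real.sqrt (1 -
        (Nat.factorial k : ℝ) * (16 * (k : ℝ) + 8 * (ℓ : ℝ) - 16) /
          (q : ℝ) ^ (2 * k - 1))) / (8 * (k : ℝ) + 4 * (ℓ : ℝ) - 8)) :
    (∀ n : ℕ, 2 * k + ℓ - 1 ≤ n →
        (q : ℝ) ^ n * (1 - c) ^ (n - (2 * k + ℓ - 2)) ≤
          (Nat.card {x : Fin n → Fin q //
            ¬HasZeroBlock k (kderiv k (readVec ℓ (List.ofFn x)))} : ℝ)) ∧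
      1 - Real.logb q (1 / (1 - c)) ≤
        Filter.liminf
          (fun n : ℕ =>
            Real.logb q
                (Set.ncard
                  (Set.range fun x : Fin n → Fin q => nucleus k ℓ (List.ofFn x))) / n)
          Filter.atTop := by
  have hk2 : (2 : ℝ) ≤ k := by exact_mod_cast hk
  have hl2 : (2 : ℝ) ≤ ℓ := by exact_mod_cast hl
  have hq2 : (2 : ℝ) ≤ q := by exact_mod_cast hq
  have hqpow : (0 : ℝ) < (q : ℝ) ^ (2 * k - 1) := by positivity
  have hratio : (k.factorial : ℝ) * (16 * k + 8 * ℓ - 16) / (q : ℝ) ^ (2 * k - 1)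
      = 4 * (4 * (k : ℝ) + 2 * ℓ - 4) * (k.factorial / (q : ℝ) ^ (2 * k - 1)) := by
    ring
  obtain ⟨hc₀, hc₁, hP⟩ := smaller_root_bounds (D := 4 * (k : ℝ) + 2 * ℓ - 4)
    (P := k.factorial / (q : ℝ) ^ (2 * k - 1)) (c := c) (by linarith) (by positivity)
    (by rw [← hratio, div_le_one hqpow]; exact hbig)
    (by rw [hc, hratio]; ring_nf)
  have hB := ncard_shiftPeriodic_le_of_root hk hkl hq hc₀ (by linarith) hP
  have hcount : ∀ n : ℕ, 2 * k + ℓ - 1 ≤ n →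
      (q : ℝ) ^ n * (1 - c) ^ (n - (2 * k + ℓ - 2)) ≤
        (Nat.card {x : Fin n → Fin q //
          ¬HasZeroBlock k (kderiv k (readVec ℓ (List.ofFn x)))} : ℝ) := by
    intro n hn
    have h := le_ncard_avoiding _ (by omega) hc₀ (by linarith) hB
      (show ℓ + 2 * k - 1 - 1 ≤ n by omega)
    rw [Fintype.card_fin, show ℓ + 2 * k - 1 - 1 = 2 * k + ℓ - 2 by omega] at h
    exact h.trans (mod_cast ncard_avoiding_le_card_not_hasZeroBlock (by omega) hkl hn)
  refine ⟨hcount, ?_⟩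
  have hq1 : (1 : ℝ) < q := by linarith
  have hnuc : ∀ n : ℕ, 2 * k + ℓ - 1 ≤ n → ((q : ℝ) * (1 - c)) ^ n ≤
      (Set.range fun x : Fin n → Fin q => nucleus k ℓ (List.ofFn x)).ncard := by
    intro n hn
    refine le_trans ?_ ((hcount n hn).trans
      (mod_cast card_not_hasZeroBlock_le_ncard_nucleus (by omega) (by omega)))
    rw [mul_pow]
    exact mul_le_mul_of_nonneg_left
      (pow_le_pow_of_le_one (by linarith) (by linarith) (Nat.sub_le _ _)) (by positivity)
  have hrate : 1 - Real.logb q (1 / (1 - c)) = Real.logb q (q * (1 - c)) := by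
    rw [one_div, Real.logb_inv, Real.logb_mul (by linarith) (by linarith),
      Real.logb_self_eq_one hq1]
    ring
  rw [hrate]
  have hpos : 0 < (q : ℝ) * (1 - c) := mul_pos (by linarith) (by linarith)
  have hlow : ∀ᶠ n : ℕ in Filter.atTop, Real.logb q (q * (1 - c)) ≤
      Real.logb q (Set.ncard
        (Set.range fun x : Fin n → Fin q => nucleus k ℓ (List.ofFn x))) / n := by
    filter_upwards [Filter.eventually_ge_atTop (2 * k + ℓ - 1)] with n hn
    have hn₀ : (0 : ℝ) < n := by exact_mod_cast (by omega : 0 < n)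
    rw [le_div_iff₀ hn₀, mul_comm, ← Real.logb_pow]
    exact Real.logb_le_logb_of_le hq1 (pow_pos hpos n) (hnuc n hn)
  have hup : ∀ᶠ n : ℕ in Filter.atTop, Real.logb q (Set.ncard
      (Set.range fun x : Fin n → Fin q => nucleus k ℓ (List.ofFn x))) / n ≤ 1 := by
    filter_upwards [Filter.eventually_ge_atTop (2 * k + ℓ - 1)] with n hn
    have hn₀ : (0 : ℝ) < n := by exact_mod_cast (by omega : 0 < n)
    rw [div_le_one hn₀, Real.logb_le_iff_le_rpow hq1 ((pow_pos hpos n).trans_le (hnuc n hn)),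
      Real.rpow_natCast]
    exact_mod_cast ncard_range_nucleus_le q k ℓ n
  exact Filter.le_liminf_of_le
    (Filter.IsBoundedUnder.isCoboundedUnder_ge ⟨1, hup⟩) hlow
end

section
/- Let q ≥ 2 and k, ℓ ≥ 2 be integers. Let W be the set of words w = (w_1,...,w_{2k+ℓ−1}) ∈ Z_q^{2k+ℓ−1} such that for every j ∈ {0,1,...,k−1} the composition c(w_{j+1},...,w_{j+ℓ}) equals the composition c(w_{j+k+1},...,w_{j+k+ℓ}). Then |W| ≤ ℓ!·q^k if ℓ ≤ k, and |W| ≤ k!·q^ℓ if ℓ > k. -/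
/-- Number of occurrences of `a` in the prefix of length `t`, in additive form. -/
theorem count_take_add {α : Type*} [DecidableEq α] (L : List α) (a : α) (j t : ℕ) :
    (L.take (j + t)).count a = (L.take j).count a + ((L.drop j).take t).count a := by
  rw [List.take_add, List.count_append]

/-- Equality of the compositions of two windows of length `ℓ` at distance `k`, expressed
through prefix counts; this form is symmetric in `k` and `ℓ`. -/
theorem prefix_count_of_comp_eq {q k ℓ j : ℕ} {L : List (Fin q)}
    (h : comp ((L.drop j).take ℓ) = comp ((L.drop (j + k)).take ℓ)) (a : Fin q) :
    (L.take j).count a + (L.take (j + (k + ℓ))).count a =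
      (L.take (j + k)).count a + (L.take (j + ℓ)).count a := by
  have ha : ((L.drop j).take ℓ).count a = ((L.drop (j + k)).take ℓ).count a := by
    have := congrFun h a
    simpa only [comp, Nat.cast_inj] using this
  rw [← Nat.add_assoc, count_take_add L a (j + k) ℓ, count_take_add L a j ℓ, ha]
  omega

/-- If the prefix counts satisfy the additive relation at `0`, then the window of length `m`
at position `n` is a rearrangement of the prefix of length `m`. -/
theorem perm_window_of_prefix_count {α : Type*} [DecidableEq α] {m n : ℕ} {L : List α}
    (h : ∀ a, (L.take 0).count a + (L.take (0 + (m + n))).count a =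
      (L.take (0 + m)).count a + (L.take (0 + n)).count a) :
    ((L.drop n).take m).Perm (L.take m) := by
  rw [List.perm_iff_count]
  intro a
  have h1 := h a
  have h2 := count_take_add L a n m
  simp only [Nat.zero_add, List.take_zero, List.count_nil] at h1
  rw [Nat.add_comm m n] at h1
  omega

/-- Two words satisfying the prefix-count relations which agree on their first `m + n` letters
agree on their first `m + n + t` letters. -/
theorem take_eq_of_prefix_count {α : Type*} [DecidableEq α] {k m n : ℕ} (hm : 1 ≤ m) (hn : 1 ≤ n)
    {L L' : List α} (hlen : L.length = L'.length)
    (h : ∀ j < k, ∀ a, (L.take j).count a + (L.take (j + (m + n))).count a =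
      (L.take (j + m)).count a + (L.take (j + n)).count a)
    (h' : ∀ j < k, ∀ a, (L'.take j).count a + (L'.take (j + (m + n))).count a =
      (L'.take (j + m)).count a + (L'.take (j + n)).count a)
    (heq : L.take (m + n) = L'.take (m + n)) :
    ∀ t < k, L.take (t + (m + n)) = L'.take (t + (m + n)) := by
  intro t
  induction t with
  | zero => intro _; simpa using heq
  | succ t ih =>
    intro ht
    have ih := ih (by omega)
    have sub : ∀ s ≤ t + (m + n), L.take s = L'.take s := by
      intro s hs
      have := congrArg (List.take s) ih
      simpa [List.take_take, Nat.min_eq_left hs] using this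
    have hp : (L.take (t + 1 + (m + n))).Perm (L'.take (t + 1 + (m + n))) := by
      rw [List.perm_iff_count]
      intro a
      have e := h (t + 1) ht a
      have e' := h' (t + 1) ht a
      rw [sub (t + 1) (by omega), sub (t + 1 + m) (by omega), sub (t + 1 + n) (by omega)] at e
      omega
    have hidx : t + 1 + (m + n) = t + (m + n) + 1 := by omega
    rw [hidx] at hp ⊢
    by_cases hs : t + (m + n) < L.length
    · rw [List.take_succ_eq_append_getElem hs,
        List.take_succ_eq_append_getElem (hlen ▸ hs), ih] at hp ⊢
      rw [List.perm_append_left_iff, List.singleton_perm_singleton] at hp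
      rw [hp]
    · rw [List.take_of_length_le (by omega), List.take_of_length_le (by omega)] at ih ⊢
      exact ih

/-- A set of words of length `N ≤ m + n + k - 1` satisfying the prefix-count relations has at
most `m! * q ^ n` elements, provided `m ≤ n`. -/
theorem card_le_of_prefix_count {q k m n N : ℕ} (hk : 1 ≤ k) (hm : 1 ≤ m) (hmn : m ≤ n)
    (hn : n ≤ N) (hN : N ≤ k - 1 + (m + n)) (P : (Fin N → Fin q) → Prop)
    (hP : ∀ w, P w → ∀ j < k, ∀ a,
      ((List.ofFn w).take j).count a + ((List.ofFn w).take (j + (m + n))).count a =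
        ((List.ofFn w).take (j + m)).count a + ((List.ofFn w).take (j + n)).count a) :
    Nat.card {w : Fin N → Fin q // P w} ≤ Nat.factorial m * q ^ n := by
  have hmem : ∀ w, P w →
      ((List.ofFn w).drop n).take m ∈ ((List.ofFn w).take m).permutations := fun w hw =>
    List.mem_permutations.2 (perm_window_of_prefix_count (hP w hw 0 (by omega)))
  have hidx : ∀ w : {w : Fin N → Fin q // P w},
      ((List.ofFn w.1).take m).permutations.idxOf (((List.ofFn w.1).drop n).take m) <
        Nat.factorial m := by
    intro w
    have h1 := List.idxOf_lt_length_iff.2 (hmem w.1 w.2)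
    rw [List.length_permutations, List.length_take, List.length_ofFn,
      Nat.min_eq_left (by omega)] at h1
    exact h1
  let f : {w : Fin N → Fin q // P w} → Fin (Nat.factorial m) × (Fin n → Fin q) := fun w =>
    (⟨_, hidx w⟩, fun i => w.1 (Fin.castLE hn i))
  have hf : Function.Injective f := by
    rintro ⟨w, hw⟩ ⟨w', hw'⟩ hww
    have hi := congrArg (fun p => p.1.1) hww
    have hv := congrArg Prod.snd hww
    simp only [f] at hi hv
    have hpre : (List.ofFn w).take n = (List.ofFn w').take n := by
      apply List.ext_getElem (by simp)
      intro i h1 h2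
      simp only [List.length_take, List.length_ofFn] at h1
      have hvi := congrFun hv ⟨i, by omega⟩
      simp only [List.getElem_take, List.getElem_ofFn]
      exact hvi
    have hpre_m : (List.ofFn w).take m = (List.ofFn w').take m := by
      have := congrArg (List.take m) hpre
      simpa [List.take_take, Nat.min_eq_left hmn] using this
    rw [hpre_m] at hi
    have hmem_w := hmem w hw
    rw [hpre_m] at hmem_w
    have hwin := (List.idxOf_inj hmem_w).1 hi
    have hmid : (List.ofFn w).take (m + n) = (List.ofFn w').take (m + n) := by
      rw [Nat.add_comm, List.take_add, List.take_add, hpre, hwin]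
    have hall := take_eq_of_prefix_count hm (hm.trans hmn) (by simp) (hP w hw) (hP w' hw') hmid
      (k - 1) (by omega)
    rw [List.take_of_length_le (by simpa using hN), List.take_of_length_le (by simpa using hN)]
      at hall
    exact Subtype.ext (List.ofFn_injective hall)
  calc Nat.card {w : Fin N → Fin q // P w}
      ≤ Nat.card (Fin (Nat.factorial m) × (Fin n → Fin q)) := Nat.card_le_card_of_injective f hf
    _ = Nat.factorial m * q ^ n := by simp

/-- the number of words `w ∈ Z_q^{2k+ℓ−1}` such that for every
`j ∈ {0,...,k−1}` the compositions `c(w_{j+1},...,w_{j+ℓ})` and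
`c(w_{j+k+1},...,w_{j+k+ℓ})` coincide is at most `ℓ!·q^k` if `ℓ ≤ k`, and at
most `k!·q^ℓ` if `ℓ > k`. -/
theorem stmt_16 (q k ℓ : ℕ) (hq : 2 ≤ q) (hk : 2 ≤ k) (hl : 2 ≤ ℓ) :
    (ℓ ≤ k →
      Nat.card {w : Fin (2 * k + ℓ - 1) → Fin q //
          ∀ j : ℕ, j < k →
            comp (((List.ofFn w).drop j).take ℓ) =
              comp (((List.ofFn w).drop (j + k)).take ℓ)} ≤
        Nat.factorial ℓ * q ^ k) ∧
    (k < ℓ →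
      Nat.card {w : Fin (2 * k + ℓ - 1) → Fin q //
          ∀ j : ℕ, j < k →
            comp (((List.ofFn w).drop j).take ℓ) =
              comp (((List.ofFn w).drop (j + k)).take ℓ)} ≤
        Nat.factorial k * q ^ ℓ) := by
  constructor
  · intro h
    refine card_le_of_prefix_count (k := k) (by omega) (by omega) h (by omega) (by omega) _ ?_
    intro w hw j hj a
    have := prefix_count_of_comp_eq (hw j hj) a
    rw [Nat.add_comm ℓ k]
    omega
  · intro h
    refine card_le_of_prefix_count (k := k) (by omega) (by omega) h.le (by omega) (by omega) _ ?_
    intro w hw j hj a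
    exact prefix_count_of_comp_eq (hw j hj) a
end

section
/- Let q ≥ 2 and k, ℓ, t ≥ 1 be fixed integers with ℓ | k. There exists a constant A > 0 (depending only on q, k, ℓ, t) such that for every n ≥ 1, every code C ⊆ Z_q^n satisfying B_{k,t}(R_ℓ(x)) ∩ B_{k,t}(R_ℓ(x')) = ∅ for all distinct x, x' ∈ C has |C| ≤ A·q^n/n^t; equivalently, every code of length n over Z_q correcting t tandem duplications of length k in the ℓ-read channel has redundancy at least t·log_q n + O(1). -/
theorem take_drop_append_replicate {α : Type*} {a : α} {u w : List α} {j ℓ m : ℕ}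
    (h : j + ℓ ≤ m) :
    ((u ++ (List.replicate m a ++ w)).drop (u.length + j)).take ℓ = List.replicate ℓ a := by
  rw [List.drop_length_add_append, List.drop_append_of_le_length (by simp; omega),
    List.take_append_of_le_length (by simp; omega), List.drop_replicate, List.take_replicate,
    min_eq_left (by omega)]

/-- Lengthening a run of at least `k + ℓ - 1` equal letters by `k` acts on the `ℓ`-read vector
as a tandem duplication of length `k`. -/
theorem TD_readVec_replicate {q k ℓ : ℕ} (hl : 1 ≤ ℓ) (a : Fin q) (u w : List (Fin q)) :
    TD k (readVec ℓ (u ++ (List.replicate (k + ℓ - 1) a ++ w)))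
      (readVec ℓ (u ++ (List.replicate (k + ℓ - 1 + k) a ++ w))) := by
  set x := u ++ (List.replicate (k + ℓ - 1) a ++ w) with hx
  set y := u ++ (List.replicate (k + ℓ - 1 + k) a ++ w) with hy
  have hxl : x.length + ℓ - 1 = (u.length + ℓ - 1) + (k + (w.length + ℓ - 1)) := by
    simp [hx]; omega
  have hyl : y.length + ℓ - 1 = (u.length + ℓ - 1) + (k + (k + (w.length + ℓ - 1))) := by
    simp [hy]; omega
  refine ⟨(List.range (u.length + ℓ - 1)).map fun p => comp ((x.take (p + 1)).drop (p + 1 - ℓ)),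
    List.replicate k (comp (List.replicate ℓ a)),
    (List.range (w.length + ℓ - 1)).map fun i =>
      comp (((List.replicate (ℓ - 1) a ++ w).drop i).take ℓ), by simp, ?_, ?_⟩
  · rw [readVec, hxl, List.range_add, List.map_append, List.range_add, List.map_append,
      List.map_append]
    congr 1
    congr 1
    · rw [List.eq_replicate_iff]
      refine ⟨by simp, ?_⟩
      simp only [List.map_map, List.mem_map, List.mem_range, Function.comp]
      rintro _ ⟨i, hi, rfl⟩
      congr 1
      have h1 : u.length + ℓ - 1 + i + 1 - ℓ = u.length + i := by omega
      have h2 : u.length + ℓ - 1 + i + 1 - (u.length + i) = ℓ := by omega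
      rw [List.drop_take, h1, h2, hx, take_drop_append_replicate (by omega)]
    · simp only [List.map_map]
      refine List.map_congr_left fun i _ => ?_
      simp only [Function.comp]
      congr 1
      have h1 : u.length + ℓ - 1 + (k + i) + 1 - ℓ = u.length + (k + i) := by omega
      have h2 : u.length + ℓ - 1 + (k + i) + 1 - (u.length + (k + i)) = ℓ := by omega
      have h3 : k + ℓ - 1 = k + (ℓ - 1) := by omega
      rw [List.drop_take, h1, h2, hx, h3, List.replicate_add, List.append_assoc,
        List.drop_length_add_append, ← List.drop_drop]
      rw [List.drop_left' (by simp)]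
  · rw [readVec, hyl, List.range_add, List.map_append, List.range_add, List.map_append,
      List.map_append, List.range_add, List.map_append, List.map_append, List.map_append]
    congr 1
    · refine List.map_congr_left fun p hp => ?_
      rw [List.mem_range] at hp
      have h4 : y.take (p + 1) = x.take (p + 1) := by
        have hlt : p + 1 ≤ (u ++ List.replicate (k + ℓ - 1) a).length := by
          simp only [List.length_append, List.length_replicate]
          omega
        rw [hx, hy, List.replicate_add, List.append_assoc, ← List.append_assoc u,
          ← List.append_assoc u, List.take_append_of_le_length hlt,
          List.take_append_of_le_length hlt]
      rw [h4]
    congr 1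
    · rw [List.eq_replicate_iff]
      refine ⟨by simp, ?_⟩
      simp only [List.map_map, List.mem_map, List.mem_range, Function.comp]
      rintro _ ⟨i, hi, rfl⟩
      congr 1
      have h1 : u.length + ℓ - 1 + i + 1 - ℓ = u.length + i := by omega
      have h2 : u.length + ℓ - 1 + i + 1 - (u.length + i) = ℓ := by omega
      rw [List.drop_take, h1, h2, hy, take_drop_append_replicate (by omega)]
    congr 1
    · rw [List.eq_replicate_iff]
      refine ⟨by simp, ?_⟩
      simp only [List.map_map, List.mem_map, List.mem_range, Function.comp]
      rintro _ ⟨i, hi, rfl⟩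
      congr 1
      have h1 : u.length + ℓ - 1 + (k + i) + 1 - ℓ = u.length + (k + i) := by omega
      have h2 : u.length + ℓ - 1 + (k + i) + 1 - (u.length + (k + i)) = ℓ := by omega
      rw [List.drop_take, h1, h2, hy, take_drop_append_replicate (by omega)]
    · simp only [List.map_map]
      refine List.map_congr_left fun i _ => ?_
      simp only [Function.comp]
      congr 1
      have h1 : u.length + ℓ - 1 + (k + (k + i)) + 1 - ℓ = u.length + (k + (k + i)) := by omega
      have h2 : u.length + ℓ - 1 + (k + (k + i)) + 1 - (u.length + (k + (k + i))) = ℓ := by omega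
      have h3 : k + ℓ - 1 + k = k + (k + (ℓ - 1)) := by omega
      rw [List.drop_take, h1, h2, hy, h3, List.replicate_add, List.replicate_add,
        List.append_assoc, List.append_assoc,
        List.drop_length_add_append, ← List.drop_drop, ← List.drop_drop]
      rw [List.drop_left' (by simp), List.drop_left' (by simp)]

/-- The number of the first `N` consecutive blocks of `x` (of length `|B|`) which equal `B`. -/
def blockCount {α : Type*} [DecidableEq α] (B : List α) : ℕ → List α → ℕ
  | 0, _ => 0
  | N + 1, x => blockCount B N (x.drop B.length) + if x.take B.length = B then 1 else 0

/-- The words obtained from `x` by replacing by `B'` exactly `j` of the blocks equal to `B`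
among its first `N` consecutive blocks of length `|B|`. -/
def blockSubst {α : Type*} [DecidableEq α] (B B' : List α) : ℕ → ℕ → List α → Finset (List α)
  | 0, 0, x => {x}
  | 0, _ + 1, _ => ∅
  | N + 1, 0, x => (blockSubst B B' N 0 (x.drop B.length)).image (x.take B.length ++ ·)
  | N + 1, j + 1, x =>
    (blockSubst B B' N (j + 1) (x.drop B.length)).image (x.take B.length ++ ·) ∪
      if x.take B.length = B then (blockSubst B B' N j (x.drop B.length)).image (B' ++ ·) else ∅

theorem card_blockSubst {α : Type*} [DecidableEq α] {B B' : List α}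
    (hB : ∀ y z, B ++ y ≠ B' ++ z) (N j : ℕ) (x : List α) :
    (blockSubst B B' N j x).card = (blockCount B N x).choose j := by
  induction N generalizing j x with
  | zero => cases j <;> simp [blockSubst, blockCount]
  | succ N ih =>
    have inj (u : List α) : Function.Injective (u ++ ·) := fun _ _ h => List.append_cancel_left h
    cases j with
    | zero => rw [blockSubst, Finset.card_image_of_injective _ (inj _), ih]; simp
    | succ j =>
      rw [blockSubst, blockCount]
      split_ifs with h
      · rw [Finset.card_union_of_disjoint, Finset.card_image_of_injective _ (inj _),
          Finset.card_image_of_injective _ (inj _), ih, ih, Nat.choose_succ_succ', add_comm]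
        rw [Finset.disjoint_left, h]
        simp only [Finset.mem_image]
        rintro _ ⟨y, _, rfl⟩ ⟨z, _, hz⟩
        exact hB y z hz.symm
      · rw [Finset.union_empty, Finset.card_image_of_injective _ (inj _), ih, add_zero]

theorem length_of_mem_blockSubst {α : Type*} [DecidableEq α] {B B' : List α} {k : ℕ}
    (hB : B'.length = B.length + k) {N j : ℕ} {x y : List α}
    (hy : y ∈ blockSubst B B' N j x) : y.length = x.length + j * k := by
  induction N generalizing j x y with
  | zero => cases j <;> simp_all [blockSubst]
  | succ N ih =>
    cases j with
    | zero =>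
      simp only [blockSubst, Finset.mem_image] at hy
      obtain ⟨z, hz, rfl⟩ := hy
      rw [List.length_append, ih hz, ← add_assoc, ← List.length_append, List.take_append_drop]
    | succ j =>
      simp only [blockSubst, Finset.mem_union, Finset.mem_image] at hy
      rcases hy with ⟨z, hz, rfl⟩ | hy
      · rw [List.length_append, ih hz, ← add_assoc, ← List.length_append, List.take_append_drop]
      · split_ifs at hy with h
        · obtain ⟨z, hz, rfl⟩ := Finset.mem_image.1 hy
          have hx := congrArg List.length (List.take_append_drop B.length x)
          rw [h, List.length_append] at hx
          rw [List.length_append, ih hz, hB, ← hx]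
          ring
        · simp at hy

theorem TDt_readVec_of_mem_blockSubst {q k ℓ : ℕ} {B B' : List (Fin q)}
    (hB : ∀ u w, TD k (readVec ℓ (u ++ (B ++ w))) (readVec ℓ (u ++ (B' ++ w))))
    {N j : ℕ} {x y : List (Fin q)} (hy : y ∈ blockSubst B B' N j x) (u : List (Fin q)) :
    TDt k j (readVec ℓ (u ++ x)) (readVec ℓ (u ++ y)) := by
  induction N generalizing j x y u with
  | zero =>
    cases j with
    | zero => simp only [blockSubst, Finset.mem_singleton] at hy; rw [hy]; rfl
    | succ j => simp [blockSubst] at hy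
  | succ N ih =>
    have key {j : ℕ} {z : List (Fin q)} (hz : z ∈ blockSubst B B' N j (x.drop B.length)) :
        TDt k j (readVec ℓ (u ++ x)) (readVec ℓ (u ++ (x.take B.length ++ z))) := by
      have := ih hz (u ++ x.take B.length)
      rwa [List.append_assoc, List.append_assoc, List.take_append_drop] at this
    cases j with
    | zero =>
      simp only [blockSubst, Finset.mem_image] at hy
      obtain ⟨z, hz, rfl⟩ := hy
      exact key hz
    | succ j =>
      simp only [blockSubst, Finset.mem_union, Finset.mem_image] at hy
      rcases hy with ⟨z, hz, rfl⟩ | hy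
      · exact key hz
      · split_ifs at hy with h
        · obtain ⟨z, hz, rfl⟩ := Finset.mem_image.1 hy
          have hk := key hz
          rw [h] at hk
          exact ⟨_, hk, hB u z⟩
        · simp at hy

/-- The generating function of `blockCount` at `1/2`, over all words of a given length. -/
theorem sum_half_pow_blockCount {α : Type*} [Fintype α] [DecidableEq α] (B : List α)
    (N s n : ℕ) (hn : n = N * B.length + s) :
    ∑ x : Fin n → α, (1 / 2 : ℝ) ^ blockCount B N (List.ofFn x) =
      ((Fintype.card α : ℝ) ^ B.length - 1 / 2) ^ N * (Fintype.card α : ℝ) ^ s := by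
  induction N generalizing n with
  | zero => simp [blockCount, hn]
  | succ N ih =>
    obtain rfl : n = B.length + (N * B.length + s) := by rw [hn]; ring
    have hblock : ∑ h : Fin B.length → α, (1 / 2 : ℝ) ^ (if List.ofFn h = B then 1 else 0) =
        (Fintype.card α : ℝ) ^ B.length - 1 / 2 := by
      have hiff (h : Fin B.length → α) : List.ofFn h = B ↔ h = B.get := by
        constructor
        · intro e
          apply List.ofFn_injective
          rw [e, List.ofFn_get]
        · rintro rfl
          exact List.ofFn_get B
      have hsplit (h : Fin B.length → α) : (1 / 2 : ℝ) ^ (if List.ofFn h = B then 1 else 0) =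
          1 - if h = B.get then 1 / 2 else 0 := by
        simp only [hiff]
        split_ifs <;> norm_num
      simp only [hsplit, Finset.sum_sub_distrib]
      simp
    rw [← (Fin.appendEquiv B.length (N * B.length + s)).sum_comp, Fintype.sum_prod_type]
    have hterm (h : Fin B.length → α) (r : Fin (N * B.length + s) → α) :
        (1 / 2 : ℝ) ^ blockCount B (N + 1) (List.ofFn (Fin.appendEquiv _ _ (h, r))) =
          (1 / 2 : ℝ) ^ (if List.ofFn h = B then 1 else 0) *
            (1 / 2 : ℝ) ^ blockCount B N (List.ofFn r) := by
      have happ : Fin.appendEquiv B.length (N * B.length + s) (h, r) = Fin.append h r := rfl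
      rw [← pow_add, happ, List.ofFn_fin_append, blockCount,
        List.drop_left' (by simp), List.take_left' (by simp), add_comm]
    simp only [hterm, ← Finset.mul_sum]
    rw [← Finset.sum_mul, hblock, ih _ rfl, pow_succ]
    ring

/-- A Chernoff-type bound: few words have fewer than `d` blocks equal to `B`. -/
theorem card_filter_blockCount_lt_le {q : ℕ} (hq : 0 < q) (B : List (Fin q)) (N n d : ℕ)
    (hn : N * B.length ≤ n) (C : Finset (Fin n → Fin q)) :
    ((C.filter fun x => blockCount B N (List.ofFn x) < d).card : ℝ) ≤
      2 ^ d * (1 - 1 / (2 * (q : ℝ) ^ B.length)) ^ N * (q : ℝ) ^ n := by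
  obtain ⟨s, rfl⟩ := Nat.exists_eq_add_of_le hn
  have hq' : (0 : ℝ) < q := by exact_mod_cast hq
  have hsum := sum_half_pow_blockCount B N s _ rfl
  rw [Fintype.card_fin] at hsum
  have hrhs : (1 - 1 / (2 * (q : ℝ) ^ B.length)) ^ N * (q : ℝ) ^ (N * B.length + s) =
      ((q : ℝ) ^ B.length - 1 / 2) ^ N * (q : ℝ) ^ s := by
    rw [pow_add, mul_comm N, pow_mul, ← mul_assoc, ← mul_pow]
    congr 2
    field_simp
  rw [mul_assoc, hrhs, ← hsum, Finset.mul_sum, Finset.card_eq_sum_ones, Nat.cast_sum]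
  refine (Finset.sum_le_sum fun x hx => ?_).trans
    (Finset.sum_le_sum_of_subset_of_nonneg (Finset.subset_univ _) fun _ _ _ => by positivity)
  have hlt := (Finset.mem_filter.1 hx).2
  rw [one_div, inv_pow, ← div_eq_mul_inv, Nat.cast_one, one_le_div (by positivity)]
  exact pow_le_pow_right₀ (by norm_num) hlt.le

/-- Packing bound: the words obtained from distinct codewords by block substitution are
distinct. -/
theorem sum_choose_blockCount_le {q k ℓ t : ℕ} {B B' : List (Fin q)}
    (hpre : ∀ y z, B ++ y ≠ B' ++ z) (hlen : B'.length = B.length + k)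
    (hTD : ∀ u w, TD k (readVec ℓ (u ++ (B ++ w))) (readVec ℓ (u ++ (B' ++ w))))
    {n : ℕ} (N : ℕ) (C : Finset (Fin n → Fin q))
    (hC : ∀ x ∈ C, ∀ x' ∈ C, x ≠ x' →
      Ball k t (readVec ℓ (List.ofFn x)) ∩ Ball k t (readVec ℓ (List.ofFn x')) = ∅) :
    ∑ x ∈ C, (blockCount B N (List.ofFn x)).choose t ≤ q ^ (n + t * k) := by
  have hball {x : Fin n → Fin q} {y : List (Fin q)}
      (hy : y ∈ blockSubst B B' N t (List.ofFn x)) :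
      readVec ℓ y ∈ Ball k t (readVec ℓ (List.ofFn x)) :=
    ⟨t, le_rfl, TDt_readVec_of_mem_blockSubst hTD hy []⟩
  calc ∑ x ∈ C, (blockCount B N (List.ofFn x)).choose t
      = (C.biUnion fun x => blockSubst B B' N t (List.ofFn x)).card := by
        rw [Finset.card_biUnion]
        · simp only [card_blockSubst hpre]
        · intro x hx x' hx' hne
          refine Finset.disjoint_left.2 ?_
          intro y hy hy'
          have : readVec ℓ y ∈ Ball k t (readVec ℓ (List.ofFn x)) ∩
              Ball k t (readVec ℓ (List.ofFn x')) := ⟨hball hy, hball hy'⟩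
          rw [hC x hx x' hx' hne] at this
          exact this
    _ ≤ ((Finset.univ : Finset (Fin (n + t * k) → Fin q)).image List.ofFn).card := by
        refine Finset.card_le_card fun y hy => ?_
        obtain ⟨x, _, hy⟩ := Finset.mem_biUnion.1 hy
        have hl : y.length = n + t * k := by
          rw [length_of_mem_blockSubst hlen hy, List.length_ofFn]
        rw [Finset.mem_image]
        refine ⟨fun i => y.get (i.cast hl.symm), Finset.mem_univ _, ?_⟩
        refine List.ext_getElem (by simp [hl]) fun i _ _ => by simp
    _ ≤ q ^ (n + t * k) := by
        refine Finset.card_image_le.trans ?_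
        simp

/-- The code size is at most the sum of a packing term, for words with at least `d` blocks equal
to `B`, and an exponentially small term, for the remaining words. -/
theorem card_mul_pow_le {q k ℓ t : ℕ} (hq : 0 < q) {B B' : List (Fin q)}
    (hpre : ∀ y z, B ++ y ≠ B' ++ z) (hlen : B'.length = B.length + k)
    (hTD : ∀ u w, TD k (readVec ℓ (u ++ (B ++ w))) (readVec ℓ (u ++ (B' ++ w))))
    {g : ℕ} (hg : (1 - 1 / (2 * (q : ℝ) ^ B.length)) ^ g ≤ 1 / 4)
    {n d : ℕ} (hdn : g * d * B.length ≤ n) (htd : t ≤ d) (C : Finset (Fin n → Fin q))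
    (hC : ∀ x ∈ C, ∀ x' ∈ C, x ≠ x' →
      Ball k t (readVec ℓ (List.ofFn x)) ∩ Ball k t (readVec ℓ (List.ofFn x')) = ∅) :
    (C.card : ℝ) * ((d : ℝ) + 1) ^ t ≤
      (((t : ℝ) + 1) ^ t * t.factorial * (q : ℝ) ^ (t * k) +
        ((d : ℝ) + 1) ^ t * (1 / 2) ^ d) * (q : ℝ) ^ n := by
  set r : (Fin n → Fin q) → ℕ := fun x => blockCount B (g * d) (List.ofFn x) with hr
  have hq1 : (1 : ℝ) ≤ (q : ℝ) ^ B.length := one_le_pow₀ (by exact_mod_cast hq)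
  have hfew : ((C.filter fun x => r x < d).card : ℝ) ≤ (1 / 2) ^ d * (q : ℝ) ^ n := by
    refine (card_filter_blockCount_lt_le hq B (g * d) n d hdn C).trans ?_
    gcongr
    have h0 : (0 : ℝ) ≤ 1 - 1 / (2 * (q : ℝ) ^ B.length) := by
      rw [sub_nonneg, div_le_one (by positivity)]
      linarith
    calc (2 : ℝ) ^ d * (1 - 1 / (2 * (q : ℝ) ^ B.length)) ^ (g * d)
        ≤ 2 ^ d * (1 / 4) ^ d := by rw [pow_mul]; gcongr
      _ = (1 / 2) ^ d := by rw [← mul_pow]; norm_num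
  have hmany : ((C.filter fun x => ¬ r x < d).card : ℝ) * ((d : ℝ) + 1) ^ t ≤
      ((t : ℝ) + 1) ^ t * t.factorial * (q : ℝ) ^ (t * k) * (q : ℝ) ^ n := by
    have hpack : (∑ x ∈ C, ((r x).choose t : ℝ)) ≤ (q : ℝ) ^ (n + t * k) := by
      exact_mod_cast sum_choose_blockCount_le hpre hlen hTD (g * d) C hC
    have hpoint (x : Fin n → Fin q) (hx : ¬ r x < d) :
        ((d : ℝ) + 1) ^ t ≤ ((t : ℝ) + 1) ^ t * t.factorial * (r x).choose t := by
      have hd : (d + 1 : ℕ) ≤ (t + 1) * (d + 1 - t) := by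
        obtain ⟨e, rfl⟩ := Nat.exists_eq_add_of_le htd
        rw [show t + e + 1 - t = e + 1 by omega]
        nlinarith [Nat.zero_le (t * e)]
      have hd' : (d + 1) ^ t ≤ (t + 1) ^ t * (t.factorial * (r x).choose t) := by
        calc (d + 1) ^ t ≤ ((t + 1) * (d + 1 - t)) ^ t := Nat.pow_le_pow_left hd t
          _ = (t + 1) ^ t * (d + 1 - t) ^ t := mul_pow _ _ _
          _ ≤ (t + 1) ^ t * (t.factorial * (r x).choose t) := by
            refine Nat.mul_le_mul_left _ ?_
            refine (Nat.pow_le_pow_left (show d + 1 - t ≤ r x + 1 - t by omega) t).trans ?_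
            have := Nat.pow_le_choose (α := ℚ) t (r x)
            rw [div_le_iff₀' (by positivity)] at this
            exact_mod_cast this
      rw [mul_assoc]
      exact_mod_cast hd'
    calc ((C.filter fun x => ¬ r x < d).card : ℝ) * ((d : ℝ) + 1) ^ t
        = ∑ x ∈ C.filter fun x => ¬ r x < d, ((d : ℝ) + 1) ^ t := by simp
      _ ≤ ∑ x ∈ C.filter fun x => ¬ r x < d,
            ((t : ℝ) + 1) ^ t * t.factorial * (r x).choose t :=
          Finset.sum_le_sum fun x hx => hpoint x (Finset.mem_filter.1 hx).2
      _ ≤ ∑ x ∈ C, ((t : ℝ) + 1) ^ t * t.factorial * (r x).choose t :=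
          Finset.sum_le_sum_of_subset_of_nonneg (Finset.filter_subset _ _)
            fun _ _ _ => by positivity
      _ ≤ ((t : ℝ) + 1) ^ t * t.factorial * (q : ℝ) ^ (n + t * k) := by
          rw [← Finset.mul_sum]
          gcongr
      _ = _ := by rw [pow_add]; ring
  have hcard : (C.card : ℝ) = (C.filter fun x => r x < d).card +
      (C.filter fun x => ¬ r x < d).card := by
    exact_mod_cast (Finset.card_filter_add_card_filter_not _).symm
  rw [hcard, add_mul, add_mul, add_comm]
  refine add_le_add hmany ?_
  calc ((C.filter fun x => r x < d).card : ℝ) * ((d : ℝ) + 1) ^ t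
      ≤ (1 / 2) ^ d * (q : ℝ) ^ n * ((d : ℝ) + 1) ^ t := by gcongr
    _ = _ := by ring

theorem exists_succ_pow_mul_half_pow_le (t : ℕ) :
    ∃ M : ℝ, 0 ≤ M ∧ ∀ d : ℕ, ((d : ℝ) + 1) ^ t * (1 / 2) ^ d ≤ M := by
  have h := (tendsto_pow_const_mul_const_pow_of_abs_lt_one t
    (r := (1 / 2 : ℝ)) (by norm_num [abs_of_pos])).bddAbove_range
  obtain ⟨M, hM⟩ := h
  have hbound (d : ℕ) : ((d : ℝ) + 1) ^ t * (1 / 2) ^ d ≤ 2 * M := by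
    have := hM ⟨d + 1, rfl⟩
    simp only [Nat.cast_add, Nat.cast_one, pow_succ (1 / 2 : ℝ)] at this
    linarith
  exact ⟨2 * M, le_trans (by positivity) (hbound 0), hbound⟩

/-- if `ℓ ∣ k`, there is a constant `A > 0` such that for every
`n ≥ 1`, every code `C ⊆ Z_q^n` correcting `t` tandem duplications of length
`k` in the `ℓ`-read channel satisfies `|C| ≤ A·q^n/n^t` (redundancy at least
`t·log_q n + O(1)`). -/
theorem stmt_19 (q k ℓ t : ℕ) (hq : 2 ≤ q) (hk : 1 ≤ k) (hl : 1 ≤ ℓ) (ht : 1 ≤ t)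
    (hdvd : ℓ ∣ k) :
    ∃ A : ℝ, 0 < A ∧ ∀ n : ℕ, 1 ≤ n →
      ∀ C : Finset (Fin n → Fin q),
        (∀ x ∈ C, ∀ x' ∈ C, x ≠ x' →
          Ball k t (readVec ℓ (List.ofFn x)) ∩ Ball k t (readVec ℓ (List.ofFn x')) = ∅) →
        (C.card : ℝ) ≤ A * (q : ℝ) ^ n / (n : ℝ) ^ t := by
  obtain ⟨α, β, hαβ⟩ : ∃ α β : Fin q, α ≠ β :=
    ⟨⟨0, by omega⟩, ⟨1, by omega⟩, by simp [Fin.ext_iff]⟩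
  set m := k + ℓ - 1
  set B : List (Fin q) := List.replicate m α ++ [β] with hB
  set B' : List (Fin q) := List.replicate (m + k) α ++ [β] with hB'
  have hpre (y z : List (Fin q)) : B ++ y ≠ B' ++ z := by
    intro h
    rw [hB, hB', List.replicate_add, List.append_assoc, List.append_assoc, List.append_assoc]
      at h
    have h := List.append_cancel_left h
    obtain ⟨j, rfl⟩ := Nat.exists_eq_add_of_le' hk
    rw [List.replicate_succ] at h
    exact hαβ (List.cons.inj h).1.symm
  have hlen : B'.length = B.length + k := by simp [hB, hB']; omega
  have hTD (u w : List (Fin q)) :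
      TD k (readVec ℓ (u ++ (B ++ w))) (readVec ℓ (u ++ (B' ++ w))) := by
    rw [hB, hB', List.append_assoc, List.append_assoc]
    exact TD_readVec_replicate hl α u _
  have hBpos : 0 < B.length := by simp [hB]
  have hq0 : 0 < q := by omega
  have hqR : (0 : ℝ) < q := by exact_mod_cast hq0
  obtain ⟨g, hg⟩ := exists_pow_lt_of_lt_one (show (0 : ℝ) < 1 / 4 by norm_num)
    (show 1 - 1 / (2 * (q : ℝ) ^ B.length) < 1 by
      have : 0 < 1 / (2 * (q : ℝ) ^ B.length) := by positivity
      linarith)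
  have hgpos : 0 < g := by
    rcases Nat.eq_zero_or_pos g with rfl | h
    · norm_num at hg
    · exact h
  obtain ⟨M, hM0, hM⟩ := exists_succ_pow_mul_half_pow_le t
  set K : ℝ := ((t : ℝ) + 1) ^ t * t.factorial * (q : ℝ) ^ (t * k) with hK
  have hK0 : 0 < K := by positivity
  set G := g * B.length with hG
  have hGpos : 0 < G := Nat.mul_pos hgpos hBpos
  refine ⟨(G : ℝ) ^ t * (K + M + ((t : ℝ) + 1) ^ t), by positivity, fun n hn C hC => ?_⟩
  set d := n / G
  have hnd : (n : ℝ) ≤ G * ((d : ℝ) + 1) := by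
    exact_mod_cast (Nat.lt_mul_div_succ n hGpos).le
  have hcode : (C.card : ℝ) * ((d : ℝ) + 1) ^ t ≤
      (K + M + ((t : ℝ) + 1) ^ t) * (q : ℝ) ^ n := by
    rcases le_or_gt t d with htd | htd
    · refine (card_mul_pow_le hq0 hpre hlen hTD hg.le (d := d) ?_ htd C hC).trans ?_
      · calc g * d * B.length = G * d := by rw [hG]; ring
          _ ≤ n := Nat.mul_div_le n G
      · rw [← hK]
        have hMd := hM d
        have : (0 : ℝ) ≤ ((t : ℝ) + 1) ^ t := by positivity
        exact mul_le_mul_of_nonneg_right (by linarith) (by positivity)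
    · have hCq : (C.card : ℝ) ≤ (q : ℝ) ^ n := by
        have := Finset.card_le_univ C
        simp only [Fintype.card_fun, Fintype.card_fin] at this
        exact_mod_cast this
      have hdt : ((d : ℝ) + 1) ^ t ≤ ((t : ℝ) + 1) ^ t := by
        gcongr
      calc (C.card : ℝ) * ((d : ℝ) + 1) ^ t ≤ (q : ℝ) ^ n * ((t : ℝ) + 1) ^ t := by gcongr
        _ ≤ (K + M + ((t : ℝ) + 1) ^ t) * (q : ℝ) ^ n := by
          rw [mul_comm]
          gcongr
          linarith
  have hn' : (0 : ℝ) < n := by exact_mod_cast hn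
  rw [le_div_iff₀ (by positivity)]
  calc (C.card : ℝ) * (n : ℝ) ^ t ≤ C.card * (G * ((d : ℝ) + 1)) ^ t := by gcongr
    _ = (G : ℝ) ^ t * (C.card * ((d : ℝ) + 1) ^ t) := by rw [mul_pow]; ring
    _ ≤ (G : ℝ) ^ t * ((K + M + ((t : ℝ) + 1) ^ t) * (q : ℝ) ^ n) := by gcongr
    _ = _ := by ring
end
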